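/- arXiv:1308.3247 — 9 statements merged into one kernel-verified Lean document; each statement's English description precedes it below -/
import Mathlib

section
/- (Russo's Lemma, variant) Let 𝔽 ⊆ {1,2,*}^m be a monotone family. Then for every p ∈ (0,1), the map p ↦ μ_p(𝔽) is differentiable and its derivative satisfies (1/2)·as_p(𝔽) ≤ d μ_p(𝔽)/dp ≤ as_p(𝔽). -/
open Finset

/-- The alphabet `{1, 2, *}`, where `none` stands for `*` and `some j` for the
values `1, 2`. -/
abbrev Star3 := Option (Fin 2)

/-- The weight of a single symbol under the measure `μ_p`: `*` gets `1 - p`,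
each of `1` and `2` gets `p/2`. -/
noncomputable def star3Weight (p : ℝ) (a : Star3) : ℝ :=
  if a = none then 1 - p else p / 2

/-- The product measure `μ_p` of a family `𝔽 ⊆ {1,2,*}^m`. -/
noncomputable def muP (p : ℝ) {m : ℕ} (F : Finset (Fin m → Star3)) : ℝ :=
  ∑ f ∈ F, ∏ i, star3Weight p (f i)

/-- A family is monotone if changing a `*` coordinate of a member to `1` or `2`
again yields a member. -/
def MonotoneFamily {m : ℕ} (F : Finset (Fin m → Star3)) : Prop :=
  ∀ f ∈ F, ∀ i : Fin m, f i = none → ∀ j : Fin 2, Function.update f i (some j) ∈ F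

/-- The influence `Inf_i^p(𝔽)`: the `μ_p`-measure of the set of `F` with
`F|_{i=*} ∉ 𝔽` and `F|_{i=j} ∈ 𝔽` for some `j ∈ {1,2}`. -/
noncomputable def infP (p : ℝ) {m : ℕ} (F : Finset (Fin m → Star3)) (i : Fin m) : ℝ :=
  muP p (Finset.univ.filter (fun f : Fin m → Star3 =>
    Function.update f i none ∉ F ∧ ∃ j : Fin 2, Function.update f i (some j) ∈ F))

/-- The average sensitivity `as_p(𝔽) = Σ_i Inf_i^p(𝔽)`. -/
noncomputable def avgSens (p : ℝ) {m : ℕ} (F : Finset (Fin m → Star3)) : ℝ :=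
  ∑ i, infP p F i

/-- A sum over all words, grouped according to the value of the `i`-th coordinate. -/
theorem sum_eq_sum_sum_update {ι α M : Type*} [Fintype ι] [DecidableEq ι] [Fintype α]
    [DecidableEq α] [AddCommMonoid M] (i : ι) (b : α) (g : (ι → α) → M) :
    ∑ f, g f = ∑ f with f i = b, ∑ a, g (Function.update f i a) := by
  rw [← Finset.sum_product']
  refine Finset.sum_nbij' (fun f => (Function.update f i b, f i))
    (fun x => Function.update x.1 i x.2) ?_ ?_ ?_ ?_ ?_
  · simp
  · simp
  · simp
  · rintro ⟨f, a⟩ hf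
    have hf' : f i = b := by simpa using hf
    simp [← hf']
  · simp

theorem star3Weight_nonneg {p : ℝ} (hp : p ∈ Set.Icc (0 : ℝ) 1) (a : Star3) :
    0 ≤ star3Weight p a := by
  unfold star3Weight
  split_ifs <;> linarith [hp.1, hp.2]

theorem sum_star3Weight (p : ℝ) : ∑ a, star3Weight p a = 1 := by
  simp only [Fintype.sum_option, Fin.sum_univ_two, star3Weight, if_true, reduceCtorEq, if_false]
  ring

/-- The derivative in `p` of the weight of a single symbol. -/
noncomputable def star3WeightDeriv (a : Star3) : ℝ :=
  if a = none then -1 else 1 / 2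

theorem hasDerivAt_star3Weight (p : ℝ) (a : Star3) :
    HasDerivAt (fun q => star3Weight q a) (star3WeightDeriv a) p := by
  unfold star3Weight star3WeightDeriv
  split_ifs
  · exact (hasDerivAt_id p).const_sub 1
  · exact (hasDerivAt_id p).div_const 2

/-- The contribution of the `i`-th coordinate to the derivative of `μ_p(𝔽)`. -/
noncomputable def partialMuP (p : ℝ) {m : ℕ} (F : Finset (Fin m → Star3)) (i : Fin m) : ℝ :=
  ∑ f ∈ F, (∏ j ∈ univ.erase i, star3Weight p (f j)) * star3WeightDeriv (f i)

theorem hasDerivAt_muP (p : ℝ) {m : ℕ} (F : Finset (Fin m → Star3)) :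
    HasDerivAt (fun q => muP q F) (∑ i, partialMuP p F i) p := by
  unfold muP partialMuP
  rw [Finset.sum_comm]
  refine HasDerivAt.fun_sum fun f _ => ?_
  simpa only [smul_eq_mul] using
    HasDerivAt.fun_finsetProd (u := univ) fun i _ => hasDerivAt_star3Weight p (f i)

theorem prod_erase_update {ι α M : Type*} [DecidableEq ι] [CommMonoid M] (s : Finset ι)
    (w : α → M) (f : ι → α) (i : ι) (a : α) :
    ∏ j ∈ s.erase i, w (Function.update f i a j) = ∏ j ∈ s.erase i, w (f j) :=
  Finset.prod_congr rfl fun j hj => by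
    rw [Function.update_of_ne (Finset.ne_of_mem_erase hj)]

theorem partialMuP_eq (p : ℝ) {m : ℕ} (F : Finset (Fin m → Star3)) (i : Fin m) :
    partialMuP p F i = ∑ f with f i = none, (∏ j ∈ univ.erase i, star3Weight p (f j)) *
      ∑ a, if Function.update f i a ∈ F then star3WeightDeriv a else 0 := by
  rw [partialMuP, ← Finset.sum_ite_mem_eq F, sum_eq_sum_sum_update i none]
  simp only [prod_erase_update, Function.update_self, Finset.mul_sum, mul_ite, mul_zero]

theorem infP_eq (p : ℝ) {m : ℕ} (F : Finset (Fin m → Star3)) (i : Fin m) :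
    infP p F i = ∑ f with f i = none, (∏ j ∈ univ.erase i, star3Weight p (f j)) *
      if Function.update f i none ∉ F ∧ ∃ j : Fin 2, Function.update f i (some j) ∈ F
        then 1 else 0 := by
  rw [infP, muP, Finset.sum_filter, sum_eq_sum_sum_update i none]
  refine Finset.sum_congr rfl fun f _ => ?_
  simp only [Function.update_idem, ← Finset.mul_prod_erase univ _ (mem_univ i),
    prod_erase_update, Function.update_self]
  split_ifs
  · rw [← Finset.sum_mul, sum_star3Weight, one_mul, mul_one]
  · simp

theorem half_infP_le_partialMuP_and_le {p : ℝ} (hp : p ∈ Set.Icc (0 : ℝ) 1) {m : ℕ}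
    {F : Finset (Fin m → Star3)} (hF : MonotoneFamily F) (i : Fin m) :
    1 / 2 * infP p F i ≤ partialMuP p F i ∧ partialMuP p F i ≤ infP p F i := by
  have key : ∀ f : Fin m → Star3,
      (1 / 2 * (if Function.update f i none ∉ F ∧ ∃ j : Fin 2, Function.update f i (some j) ∈ F
        then (1 : ℝ) else 0) ≤
          ∑ a, if Function.update f i a ∈ F then star3WeightDeriv a else 0) ∧
      (∑ a, if Function.update f i a ∈ F then star3WeightDeriv a else 0) ≤
        if Function.update f i none ∉ F ∧ ∃ j : Fin 2, Function.update f i (some j) ∈ F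
        then (1 : ℝ) else 0 := by
    intro f
    have hmono : Function.update f i none ∈ F → ∀ j : Fin 2,
        Function.update f i (some j) ∈ F := fun h j => by
      simpa using hF _ h i (by simp) j
    simp only [Fintype.sum_option, Fin.sum_univ_two, Fin.exists_fin_two]
    by_cases h : Function.update f i none ∈ F
    · simp [h, hmono h, star3WeightDeriv]
      norm_num
    · by_cases h0 : Function.update f i (some 0) ∈ F <;>
        by_cases h1 : Function.update f i (some 1) ∈ F <;>
        simp [h, h0, h1, star3WeightDeriv] <;> norm_num
  have hw : ∀ f : Fin m → Star3, 0 ≤ ∏ j ∈ univ.erase i, star3Weight p (f j) := fun f =>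
    Finset.prod_nonneg fun j _ => star3Weight_nonneg hp (f j)
  rw [partialMuP_eq, infP_eq, Finset.mul_sum]
  constructor <;> refine Finset.sum_le_sum fun f _ => ?_
  · rw [mul_left_comm]
    exact mul_le_mul_of_nonneg_left (key f).1 (hw f)
  · exact mul_le_mul_of_nonneg_left (key f).2 (hw f)

/-- (Russo's Lemma, variant) For a monotone family `𝔽 ⊆ {1,2,*}^m` and every
`p ∈ (0,1)`, the map `p ↦ μ_p(𝔽)` is differentiable at `p` with derivative `d`
satisfying `(1/2)·as_p(𝔽) ≤ d ≤ as_p(𝔽)`. -/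
theorem russo_lemma_variant {m : ℕ} (F : Finset (Fin m → Star3))
    (hF : MonotoneFamily F) (p : ℝ) (hp : p ∈ Set.Ioo (0 : ℝ) 1) :
    ∃ d : ℝ, HasDerivAt (fun q => muP q F) d p ∧
      (1 / 2) * avgSens p F ≤ d ∧ d ≤ avgSens p F := by
  have h := half_infP_le_partialMuP_and_le (Set.Ioo_subset_Icc_self hp) hF
  refine ⟨_, hasDerivAt_muP p F, ?_, Finset.sum_le_sum fun i _ => (h i).2⟩
  rw [avgSens, Finset.mul_sum]
  exact Finset.sum_le_sum fun i _ => (h i).1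
end

section
/- Let p ∈ (0,1), δ > 0 and 𝔽 ⊆ {1,2,*}^m. If C ⊆ [m] is a (δ,p)-core of 𝔽, then μ_p^C([𝔽]_C^{3/4}) ≥ μ_p(𝔽) − 3δ, where μ_p^C denotes the measure μ_p on {1,2,*}^C and [𝔽]_C^{3/4} is the core-family of 𝔽 on C with threshold t = 3/4. -/
open Finset

/-- A family `𝔽'` depends only on the coordinates in `C`. -/
def DependsOnlyOn {m : ℕ} (F' : Finset (Fin m → Star3)) (C : Finset (Fin m)) : Prop :=
  ∀ f g : Fin m → Star3, (∀ i ∈ C, f i = g i) → (f ∈ F' ↔ g ∈ F')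

/-- `C` is a `(δ,p)`-core of `𝔽`: some family `𝔽'` depending only on the
coordinates in `C` satisfies `μ_p(𝔽 △ 𝔽') ≤ δ`. -/
def IsCore (p δ : ℝ) {m : ℕ} (F : Finset (Fin m → Star3)) (C : Finset (Fin m)) : Prop :=
  ∃ F' : Finset (Fin m → Star3), DependsOnlyOn F' C ∧ muP p ((F \ F') ∪ (F' \ F)) ≤ δ

/-- For `f ∈ {1,2,*}^m`, the probability, over `F'` drawn from `μ_p` on the
coordinates outside `C`, that the combined element `(f|_C, F')` lies in `𝔽`.
The sum ranges over representatives `g` that are `*` on `C`, weighted by the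
`μ_p`-weight of their coordinates outside `C`. -/
noncomputable def prCombine (p : ℝ) {m : ℕ} (F : Finset (Fin m → Star3))
    (C : Finset (Fin m)) (f : Fin m → Star3) : ℝ :=
  ∑ g ∈ Finset.univ.filter (fun g : Fin m → Star3 => ∀ i ∈ C, g i = none),
    (if (fun i => if i ∈ C then f i else g i) ∈ F then ∏ i ∈ Cᶜ, star3Weight p (g i) else 0)

/-- The weight of a word over an arbitrary finite index type. -/
noncomputable def wordWeight (p : ℝ) {ι : Type*} [Fintype ι] (a : ι → Star3) : ℝ :=
  ∏ i, star3Weight p (a i)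

theorem wordWeight_nonneg {p : ℝ} (hp : p ∈ Set.Ioo (0 : ℝ) 1) {ι : Type*} [Fintype ι]
    (a : ι → Star3) : 0 ≤ wordWeight p a := by
  refine Finset.prod_nonneg fun i _ => ?_
  unfold star3Weight
  split_ifs <;> linarith [hp.1, hp.2]

theorem sum_wordWeight (p : ℝ) (ι : Type*) [Fintype ι] [DecidableEq ι] :
    ∑ a : ι → Star3, wordWeight p a = 1 := by
  have h : ∑ x : Star3, star3Weight p x = 1 := by
    simp only [star3Weight, Fintype.sum_option, Fin.sum_univ_two, reduceCtorEq, if_true, if_false]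
    ring
  simp only [wordWeight]
  rw [← Fintype.piFinset_univ, ← Finset.prod_univ_sum]
  simp [h]

/-- Combine a word on `C` with a word on the complement of `C`. -/
def combineWords {m : ℕ} {C : Finset (Fin m)} (a : {i // i ∈ C} → Star3)
    (b : {i // i ∉ C} → Star3) : Fin m → Star3 :=
  fun i => if h : i ∈ C then a ⟨i, h⟩ else b ⟨i, h⟩

/-- The probability that a fixed word on `C`, completed at random outside `C`, lies in `G`. -/
noncomputable def fiberMeasure (p : ℝ) {m : ℕ} (G : Finset (Fin m → Star3))
    (C : Finset (Fin m)) (a : {i // i ∈ C} → Star3) : ℝ :=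
  ∑ b : {i // i ∉ C} → Star3, wordWeight p b * if combineWords a b ∈ G then 1 else 0

theorem prCombine_eq_fiberMeasure (p : ℝ) {m : ℕ} (G : Finset (Fin m → Star3))
    (C : Finset (Fin m)) (f : Fin m → Star3) :
    prCombine p G C f = fiberMeasure p G C (fun i => f i) := by
  unfold prCombine fiberMeasure
  refine Finset.sum_bij' (fun g _ i => g i) (fun b _ => combineWords (fun _ => none) b)
    ?_ ?_ ?_ ?_ ?_
  · simp
  · intro b _
    simp +contextual [combineWords]
  · intro g hg
    ext1 i
    by_cases hi : i ∈ C
    · simp [combineWords, hi, (Finset.mem_filter.1 hg).2 i hi]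
    · simp [combineWords, hi]
  · intro b _
    ext1 i
    simp [combineWords, i.2]
  · intro g _
    have hprod : ∏ i ∈ Cᶜ, star3Weight p (g i)
        = wordWeight p (fun i : {i // i ∉ C} => g i) :=
      Finset.prod_subtype _ (by simp) _
    have hcomb : (fun i => if i ∈ C then f i else g i)
        = combineWords (C := C) (fun i => f i) (fun i => g i) := by
      ext1 i
      simp [combineWords]
    simp [hprod, hcomb]

theorem muP_eq_sum_fiberMeasure (p : ℝ) {m : ℕ} (G : Finset (Fin m → Star3))
    (C : Finset (Fin m)) :
    muP p G = ∑ a : {i // i ∈ C} → Star3, wordWeight p a * fiberMeasure p G C a := by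
  have h : muP p G = ∑ f : Fin m → Star3, wordWeight p f * if f ∈ G then 1 else 0 := by
    simp [muP, wordWeight]
  rw [h, ← (Equiv.piEquivPiSubtypeProd (fun i => i ∈ C) (fun _ => Star3)).symm.sum_comp,
    Fintype.sum_prod_type]
  refine Finset.sum_congr rfl fun a _ => ?_
  rw [fiberMeasure, Finset.mul_sum]
  refine Finset.sum_congr rfl fun b _ => ?_
  have hw : wordWeight p (combineWords a b) = wordWeight p a * wordWeight p b := by
    unfold wordWeight
    rw [← Fintype.prod_subtype_mul_prod_subtype (fun i => i ∈ C)]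
    congr 1
    · exact Finset.prod_congr (by ext; simp) fun i _ => by simp [combineWords, i.2]
    · exact Finset.prod_congr rfl fun i _ => by simp [combineWords, i.2]
  rw [← mul_assoc, ← hw]
  rfl

theorem fiberMeasure_coreFamily (p t : ℝ) {m : ℕ} (F : Finset (Fin m → Star3))
    (C : Finset (Fin m)) (a : {i // i ∈ C} → Star3) :
    fiberMeasure p (Finset.univ.filter (fun f : Fin m → Star3 => t < prCombine p F C f)) C a
      = if t < fiberMeasure p F C a then 1 else 0 := by
  have h : ∀ b : {i // i ∉ C} → Star3,
      prCombine p F C (combineWords a b) = fiberMeasure p F C a := by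
    intro b
    rw [prCombine_eq_fiberMeasure]
    congr 1
    ext1 i
    simp [combineWords]
  rw [fiberMeasure]
  simp only [Finset.mem_filter, Finset.mem_univ, true_and, h]
  rw [← Finset.sum_mul, sum_wordWeight, one_mul]

theorem fiberMeasure_symmDiff (p : ℝ) {m : ℕ} (F F' : Finset (Fin m → Star3))
    (C : Finset (Fin m)) (hF' : DependsOnlyOn F' C) (a : {i // i ∈ C} → Star3) :
    fiberMeasure p ((F \ F') ∪ (F' \ F)) C a
      = if combineWords a (fun _ => none) ∈ F' then 1 - fiberMeasure p F C a
        else fiberMeasure p F C a := by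
  have h : ∀ b : {i // i ∉ C} → Star3,
      combineWords a b ∈ F' ↔ combineWords a (fun _ => none) ∈ F' :=
    fun b => hF' _ _ fun i hi => by simp [combineWords, hi]
  split_ifs with hS
  · rw [← sum_wordWeight p {i // i ∉ C}, fiberMeasure, fiberMeasure, ← Finset.sum_sub_distrib]
    refine Finset.sum_congr rfl fun b _ => ?_
    by_cases hb : combineWords a b ∈ F <;> simp [h b, hS, hb]
  · refine Finset.sum_congr rfl fun b _ => ?_
    simp [h b, hS]

theorem fiberMeasure_nonneg {p : ℝ} (hp : p ∈ Set.Ioo (0 : ℝ) 1) {m : ℕ}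
    (G : Finset (Fin m → Star3)) (C : Finset (Fin m)) (a : {i // i ∈ C} → Star3) :
    0 ≤ fiberMeasure p G C a :=
  Finset.sum_nonneg fun b _ => mul_nonneg (wordWeight_nonneg hp b) (by split_ifs <;> norm_num)

theorem fiberMeasure_le_one {p : ℝ} (hp : p ∈ Set.Ioo (0 : ℝ) 1) {m : ℕ}
    (G : Finset (Fin m → Star3)) (C : Finset (Fin m)) (a : {i // i ∈ C} → Star3) :
    fiberMeasure p G C a ≤ 1 := by
  rw [← sum_wordWeight p {i // i ∉ C}]
  exact Finset.sum_le_sum fun b _ =>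
    mul_le_of_le_one_right (wordWeight_nonneg hp b) (by split_ifs <;> norm_num)

/-- If `C` is a `(δ,p)`-core of `𝔽`, then the `μ_p`-measure of the core-family
`[𝔽]_C^{3/4}` (viewed as the set of elements whose restriction to `C` lies in
the core-family, which depends only on the coordinates in `C`, so its `μ_p`
measure coincides with `μ_p^C([𝔽]_C^{3/4})`) is at least `μ_p(𝔽) − 3δ`. -/
theorem coreFamily_measure {m : ℕ} (p δ : ℝ) (hp : p ∈ Set.Ioo (0 : ℝ) 1)
    (hδ : 0 < δ) (F : Finset (Fin m → Star3)) (C : Finset (Fin m))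
    (hC : IsCore p δ F C) :
    muP p F - 3 * δ ≤
      muP p (Finset.univ.filter (fun f : Fin m → Star3 => 3 / 4 < prCombine p F C f)) := by
  obtain ⟨F', hF', hle⟩ := hC
  suffices h : muP p F ≤ muP p (Finset.univ.filter
      (fun f : Fin m → Star3 => 3 / 4 < prCombine p F C f))
        + 3 * muP p ((F \ F') ∪ (F' \ F)) by linarith
  rw [muP_eq_sum_fiberMeasure p _ C, muP_eq_sum_fiberMeasure p (Finset.univ.filter _) C,
    muP_eq_sum_fiberMeasure p ((F \ F') ∪ (F' \ F)) C, Finset.mul_sum,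
    ← Finset.sum_add_distrib]
  refine Finset.sum_le_sum fun a _ => ?_
  rw [fiberMeasure_coreFamily, fiberMeasure_symmDiff p F F' C hF', mul_left_comm, ← mul_add]
  refine mul_le_mul_of_nonneg_left ?_ (wordWeight_nonneg hp a)
  have h0 := fiberMeasure_nonneg hp F C a
  have h1 := fiberMeasure_le_one hp F C a
  split_ifs <;> linarith
end

section
/- Fix p ∈ (0,1) and a constant δ > 0. There is a constant c̄_p > 0 depending only on p such that for every monotone family 𝔽 ⊆ {1,2,*}^m with μ_p(𝔽) ≥ δ, there exist a subset S ⊆ [m] with |S| ≤ c̄_p^{16/((1−p)δ)} and two elements F, F' ∈ 𝔽 such that for every j ∉ S, the pair (F(j), F'(j)) is neither (1,1) nor (2,2). -/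
open Finset

/-- The coordinates at which two words carry the same symbol different from `*`. -/
def agreeSet {m : ℕ} (f g : Fin m → Star3) : Finset (Fin m) :=
  univ.filter fun j => f j = g j ∧ f j ≠ none

/-- The words which, preceded by the symbol `a`, lie in `F`. -/
def consSection {m : ℕ} (F : Finset (Fin (m + 1) → Star3)) (a : Star3) :
    Finset (Fin m → Star3) :=
  univ.filter fun x => (Fin.cons a x : Fin (m + 1) → Star3) ∈ F

theorem mem_consSection {m : ℕ} {F : Finset (Fin (m + 1) → Star3)} {a : Star3}
    {x : Fin m → Star3} :
    x ∈ consSection F a ↔ (Fin.cons a x : Fin (m + 1) → Star3) ∈ F := by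
  simp [consSection]

theorem card_agreeSet_cons {m : ℕ} (a b : Star3) (x y : Fin m → Star3) :
    (agreeSet (Fin.cons a x : Fin (m + 1) → Star3) (Fin.cons b y)).card =
      (if a = b ∧ a ≠ none then 1 else 0) + (agreeSet x y).card := by
  simp only [agreeSet, Finset.card_filter, Fin.sum_univ_succ, Fin.cons_zero, Fin.cons_succ]

theorem sum_star3Weight_mul (p : ℝ) (φ : Star3 → ℝ) :
    ∑ a, star3Weight p a * φ a =
      (1 - p) * φ none + p / 2 * φ (some 0) + p / 2 * φ (some 1) := by
  simp [Fintype.sum_option, star3Weight, Fin.sum_univ_two]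
  ring

theorem muP_nonneg {p : ℝ} (h0 : 0 ≤ p) (h1 : p ≤ 1) {m : ℕ} (F : Finset (Fin m → Star3)) :
    0 ≤ muP p F := by
  refine Finset.sum_nonneg fun f _ => Finset.prod_nonneg fun i _ => ?_
  unfold star3Weight
  split_ifs <;> linarith

theorem muP_succ (p : ℝ) {m : ℕ} (F : Finset (Fin (m + 1) → Star3)) :
    muP p F = ∑ a, star3Weight p a * muP p (consSection F a) := by
  have h : ∀ {n : ℕ} (G : Finset (Fin n → Star3)),
      muP p G = ∑ f, if f ∈ G then ∏ i, star3Weight p (f i) else 0 := by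
    intro n G
    simp [muP]
  rw [h, ← (Fin.consEquiv fun _ => Star3).sum_comp, Fintype.sum_prod_type]
  refine Finset.sum_congr rfl fun a _ => ?_
  rw [h, Finset.mul_sum]
  refine Finset.sum_congr rfl fun x _ => ?_
  simp [mem_consSection, Fin.prod_univ_succ, Fin.consEquiv]

theorem muP_le_one {p : ℝ} (h0 : 0 ≤ p) (h1 : p ≤ 1) {m : ℕ} (F : Finset (Fin m → Star3)) :
    muP p F ≤ 1 := by
  induction m with
  | zero =>
    calc muP p F ≤ muP p univ :=
          Finset.sum_le_sum_of_subset_of_nonneg (subset_univ _) (by simp)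
      _ = 1 := by simp [muP]
  | succ m ih =>
    rw [muP_succ, sum_star3Weight_mul]
    nlinarith [ih (consSection F none), ih (consSection F (some 0)), ih (consSection F (some 1))]

/-- If `M * N` exceeds `L`, but by a factor of at most `((1 - q) / q) ^ 2`, then two averages
giving weight `q` to `M`, resp. `N`, and the remaining weight to quantities at most `L / N`,
resp. `L / M`, have product at most `L`. -/
theorem mul_le_of_weighted_bounds {q L M N f g : ℝ} (hq : 0 < q) (hq1 : q < 1) (hL : 0 < L)
    (hM : 0 < M) (hN : 0 < N) (hg : 0 ≤ g) (hMN : L ≤ M * N)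
    (hMN' : q ^ 2 * (M * N) ≤ (1 - q) ^ 2 * L)
    (hf : f * N ≤ q * (M * N) + (1 - q) * L) (hg' : g * M ≤ q * (M * N) + (1 - q) * L) :
    f * g ≤ L := by
  have hz : 0 < M * N := mul_pos hM hN
  have hq' : 0 < 1 - q := sub_pos.2 hq1
  have h1 : (f * N) * (g * M) ≤ (q * (M * N) + (1 - q) * L) * (q * (M * N) + (1 - q) * L) :=
    mul_le_mul hf hg' (by positivity) (by positivity)
  have h2 : (M * N - L) * (q ^ 2 * (M * N) - (1 - q) ^ 2 * L) ≤ 0 :=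
    mul_nonpos_of_nonneg_of_nonpos (by linarith) (by linarith)
  refine le_of_mul_le_mul_right ?_ hz
  nlinarith

/-- Products of averages over `{1, 2, *}` of functions whose pointwise products are at most `L`,
except for a bounded excess at `(1, 1)` and `(2, 2)`. -/
theorem mul_sum_star3Weight_le {p L : ℝ} (hp : 0 < p) (hp1 : p < 1) (hL : 0 < L)
    (φ ψ : Star3 → ℝ) (hφ : ∀ a, 0 ≤ φ a) (hψ : ∀ a, 0 ≤ ψ a)
    (h : ∀ a b, ¬(a = b ∧ a ≠ none) → φ a * ψ b ≤ L)
    (h' : ∀ a, (p / 2) ^ 2 * (φ a * ψ a) ≤ (1 - p / 2) ^ 2 * L) :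
    (∑ a, star3Weight p a * φ a) * (∑ a, star3Weight p a * ψ a) ≤ L := by
  simp only [sum_star3Weight_mul]
  have hn := h none none (by simp)
  have hn0 := h none (some 0) (by simp)
  have hn1 := h none (some 1) (by simp)
  have h0n := h (some 0) none (by simp)
  have h1n := h (some 1) none (by simp)
  have h01 := h (some 0) (some 1) (by simp)
  have h10 := h (some 1) (some 0) (by simp)
  have pos : ∀ a, L < φ a * ψ a → 0 < φ a ∧ 0 < ψ a := fun a ha =>
    ⟨(hφ a).lt_of_ne fun e => by rw [← e] at ha; linarith,
      (hψ a).lt_of_ne fun e => by rw [← e] at ha; linarith⟩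
  have hg : 0 ≤ (1 - p) * ψ none + p / 2 * ψ (some 0) + p / 2 * ψ (some 1) := by
    have := hψ none
    have := hψ (some 0)
    have := hψ (some 1)
    have : 0 ≤ 1 - p := by linarith
    positivity
  rcases lt_or_ge L (φ (some 0) * ψ (some 0)) with h0 | h0
  · obtain ⟨hM, hN⟩ := pos _ h0
    exact mul_le_of_weighted_bounds (q := p / 2) (by linarith) (by linarith) hL hM hN hg h0.le
      (h' _) (by nlinarith) (by nlinarith)
  rcases lt_or_ge L (φ (some 1) * ψ (some 1)) with h1 | h1
  · obtain ⟨hM, hN⟩ := pos _ h1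
    exact mul_le_of_weighted_bounds (q := p / 2) (by linarith) (by linarith) hL hM hN hg h1.le
      (h' _) (by nlinarith) (by nlinarith)
  have w : ∀ x y z : ℝ, x ≤ L → y ≤ L → z ≤ L → (1 - p) * x + p / 2 * y + p / 2 * z ≤ L := by
    intro x y z hx hy hz
    nlinarith
  have hfin := w _ _ _ (w _ _ _ hn hn0 hn1) (w _ _ _ h0n h0 h01) (w _ _ _ h1n h10 h1)
  linarith

/-- If any member of `F` and any member of `G` agree in at least `t` symbols other than `*`,
then `μ_p(F) μ_p(G) ≤ (q / (1 - q)) ^ (2 t)`, where `q = p / 2`. -/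
theorem muP_mul_muP_le {p : ℝ} (hp : 0 < p) (hp1 : p < 1) {m : ℕ} (t : ℕ)
    (F G : Finset (Fin m → Star3)) (h : ∀ f ∈ F, ∀ g ∈ G, t ≤ (agreeSet f g).card) :
    muP p F * muP p G ≤ (((p / 2) / (1 - p / 2)) ^ 2) ^ t := by
  have hq : 0 < 1 - p / 2 := by linarith
  induction m generalizing t with
  | zero =>
    rcases F.eq_empty_or_nonempty with rfl | ⟨f, hf⟩
    · simp only [muP, Finset.sum_empty, zero_mul]
      positivity
    rcases G.eq_empty_or_nonempty with rfl | ⟨g, hg⟩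
    · simp only [muP, Finset.sum_empty, mul_zero]
      positivity
    obtain rfl : t = 0 := by simpa [agreeSet] using h f hf g hg
    rw [pow_zero]
    exact mul_le_one₀ (muP_le_one hp.le hp1.le F) (muP_nonneg hp.le hp1.le G)
      (muP_le_one hp.le hp1.le G)
  | succ m ih =>
    cases t with
    | zero =>
      rw [pow_zero]
      exact mul_le_one₀ (muP_le_one hp.le hp1.le F) (muP_nonneg hp.le hp1.le G)
        (muP_le_one hp.le hp1.le G)
    | succ t =>
      have hcons : ∀ a b, ∀ x ∈ consSection F a, ∀ y ∈ consSection G b,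
          t + 1 ≤ (if a = b ∧ a ≠ none then 1 else 0) + (agreeSet x y).card := by
        intro a b x hx y hy
        rw [← card_agreeSet_cons]
        exact h _ (mem_consSection.1 hx) _ (mem_consSection.1 hy)
      rw [muP_succ p F, muP_succ p G]
      refine mul_sum_star3Weight_le hp hp1 (by positivity) _ _
        (fun a => muP_nonneg hp.le hp1.le _) (fun a => muP_nonneg hp.le hp1.le _) ?_ ?_
      · intro a b hab
        refine ih _ _ _ fun x hx y hy => ?_
        simpa [hab] using hcons a b x hx y hy
      · intro a
        have hle := ih t (consSection F a) (consSection G a) fun x hx y hy => by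
          have := hcons a a x hx y hy
          split_ifs at this <;> omega
        calc (p / 2) ^ 2 * (muP p (consSection F a) * muP p (consSection G a))
            ≤ (p / 2) ^ 2 * (((p / 2) / (1 - p / 2)) ^ 2) ^ t := by gcongr
          _ = (1 - p / 2) ^ 2 * (((p / 2) / (1 - p / 2)) ^ 2) ^ (t + 1) := by
            rw [pow_succ _ t, mul_left_comm, ← mul_pow, mul_div_cancel₀ _ hq.ne', mul_comm]

/-- For fixed `p ∈ (0,1)` there is a constant `c̄_p > 0` such that for every
`δ > 0` and every monotone family `𝔽 ⊆ {1,2,*}^m` with `μ_p(𝔽) ≥ δ`, there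
exist a set `S ⊆ [m]` with `|S| ≤ c̄_p^{16/((1-p)δ)}` and elements
`F, F' ∈ 𝔽` such that for every `j ∉ S` the pair `(F(j), F'(j))` is neither
`(1,1)` nor `(2,2)`.  Here `some 0` encodes the symbol `1` and `some 1` encodes
the symbol `2`. -/
theorem exists_cross_intersecting_pair (p : ℝ) (hp : p ∈ Set.Ioo (0 : ℝ) 1) :
    ∃ c : ℝ, 0 < c ∧ ∀ δ : ℝ, 0 < δ → ∀ m : ℕ, ∀ F : Finset (Fin m → Star3),
      MonotoneFamily F → δ ≤ muP p F →
      ∃ S : Finset (Fin m), (S.card : ℝ) ≤ c ^ (16 / ((1 - p) * δ)) ∧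
        ∃ f ∈ F, ∃ f' ∈ F, ∀ j : Fin m, j ∉ S →
          ¬(f j = some 0 ∧ f' j = some 0) ∧ ¬(f j = some 1 ∧ f' j = some 1) := by
  obtain ⟨hp0, hp1⟩ := hp
  have hp1' : 0 < 1 - p := by linarith
  have hq : 0 < 1 - p / 2 := by linarith
  set h : ℝ := (1 - p) / (p / 2) with hh
  have hpos : 0 < h := by positivity
  refine ⟨Real.exp (1 / h), Real.exp_pos _, fun δ hδ m F _ hF => ?_⟩
  set B : ℝ := Real.exp (1 / h) ^ (16 / ((1 - p) * δ)) with hB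
  have hB_le : 1 / (h * δ) ≤ B := by
    have hE : 1 / δ ≤ 16 / ((1 - p) * δ) := by
      rw [div_le_div_iff₀ hδ (by positivity)]
      nlinarith
    calc 1 / (h * δ) = 1 / h * (1 / δ) := by field_simp
      _ ≤ 1 / h * (16 / ((1 - p) * δ)) := by gcongr
      _ ≤ Real.exp (1 / h * (16 / ((1 - p) * δ))) := by
        linarith [Real.add_one_le_exp (1 / h * (16 / ((1 - p) * δ)))]
      _ = B := by rw [hB, Real.exp_mul]
  have hB0 : 0 ≤ B := by positivity
  by_contra hcon
  have hagree : ∀ f ∈ F, ∀ g ∈ F, ⌊B⌋₊ + 1 ≤ (agreeSet f g).card := by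
    intro f hf g hg
    by_contra hlt
    refine hcon ⟨agreeSet f g, (Nat.le_floor_iff hB0).1 (by omega), f, hf, g, hg, ?_⟩
    intro j hj
    constructor <;> rintro ⟨h1, h2⟩ <;> exact hj (by simp [agreeSet, h1, h2])
  have hmul := muP_mul_muP_le hp0 hp1 _ F F hagree
  set t := ⌊B⌋₊ + 1 with ht
  have ht_lt : B < t := by exact_mod_cast Nat.lt_floor_add_one B
  have hδt : δ ≤ ((p / 2) / (1 - p / 2)) ^ t := by
    refine hF.trans (le_of_sq_le_sq ?_ (by positivity))
    rw [← pow_mul, mul_comm t 2, pow_mul, sq (muP p F)]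
    exact hmul
  have hinv : (p / 2) / (1 - p / 2) = (1 + h)⁻¹ := by
    rw [hh, div_eq_iff hq.ne', eq_comm, inv_mul_eq_iff_eq_mul₀ (by positivity)]
    field_simp
    ring
  have hbern : 1 + t * h ≤ (1 + h) ^ t := one_add_mul_le_pow (by linarith) t
  rw [hinv, inv_pow] at hδt
  have hδ1 : δ * (1 + h) ^ t ≤ 1 := by
    rwa [← le_div_iff₀ (by positivity), one_div]
  have hBδ : 1 ≤ B * (h * δ) := (div_le_iff₀ (by positivity)).1 hB_le
  have h3 : B * (h * δ) < t * (h * δ) := by gcongr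
  nlinarith
end

section
/- Let (Ω¹_i × Ω²_i, μ_i), for i = 1, …, n, be finite correlated probability spaces. Then the correlation of the product spaces satisfies ρ(∏_{i=1}^n Ω¹_i, ∏_{i=1}^n Ω²_i; ∏_{i=1}^n μ_i) ≤ max_i ρ(Ω¹_i, Ω²_i; μ_i). -/
open Finset

/-- The correlation `ρ(Ω¹, Ω²; μ)` of a finite correlated probability space:
the supremum of `|E_μ[f g]|` over `f : Ω¹ → ℝ`, `g : Ω² → ℝ` with
`E[f] = E[g] = 0` and `E[f²] ≤ 1`, `E[g²] ≤ 1`. -/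
noncomputable def corr {Ω₁ Ω₂ : Type*} [Fintype Ω₁] [Fintype Ω₂]
    (μ : Ω₁ → Ω₂ → ℝ) : ℝ :=
  sSup {x : ℝ | ∃ f : Ω₁ → ℝ, ∃ g : Ω₂ → ℝ,
    (∑ a, ∑ b, μ a b * f a) = 0 ∧ (∑ a, ∑ b, μ a b * g b) = 0 ∧
    (∑ a, ∑ b, μ a b * (f a) ^ 2) ≤ 1 ∧ (∑ a, ∑ b, μ a b * (g b) ^ 2) ≤ 1 ∧
    x = |∑ a, ∑ b, μ a b * f a * g b|}

/-- The weighted sum of `h` against `μ`; for a probability weight this is `E_μ[h]`. -/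
noncomputable def weightedSum {A B : Type*} [Fintype A] [Fintype B]
    (μ : A → B → ℝ) (h : A → B → ℝ) : ℝ :=
  ∑ a, ∑ b, μ a b * h a b

section weightedSum

variable {A B : Type*} [Fintype A] [Fintype B] (μ : A → B → ℝ)

theorem weightedSum_add (h k : A → B → ℝ) :
    weightedSum μ (fun a b => h a b + k a b) = weightedSum μ h + weightedSum μ k := by
  simp only [weightedSum, mul_add, sum_add_distrib]

theorem weightedSum_sub (h k : A → B → ℝ) :
    weightedSum μ (fun a b => h a b - k a b) = weightedSum μ h - weightedSum μ k := by
  simp only [weightedSum, mul_sub, sum_sub_distrib]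

theorem weightedSum_const_mul (c : ℝ) (h : A → B → ℝ) :
    weightedSum μ (fun a b => c * h a b) = c * weightedSum μ h := by
  simp only [weightedSum, mul_sum, mul_left_comm]

theorem weightedSum_const {μ : A → B → ℝ} (hsum : ∑ a, ∑ b, μ a b = 1) (c : ℝ) :
    weightedSum μ (fun _ _ => c) = c := by
  simp only [weightedSum, ← sum_mul, hsum, one_mul]

theorem weightedSum_mono {μ : A → B → ℝ} (hnn : ∀ a b, 0 ≤ μ a b) {h k : A → B → ℝ}
    (hk : ∀ a b, h a b ≤ k a b) : weightedSum μ h ≤ weightedSum μ k :=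
  sum_le_sum fun a _ => sum_le_sum fun b _ => mul_le_mul_of_nonneg_left (hk a b) (hnn a b)

theorem weightedSum_equiv {A' B' : Type*} [Fintype A'] [Fintype B'] (e₁ : A' ≃ A) (e₂ : B' ≃ B)
    (h : A → B → ℝ) :
    weightedSum (fun a b => μ (e₁ a) (e₂ b)) (fun a b => h (e₁ a) (e₂ b)) = weightedSum μ h := by
  unfold weightedSum
  rw [← e₁.sum_comp]
  refine sum_congr rfl fun a _ => ?_
  rw [← e₂.sum_comp]

theorem weightedSum_prod {C D : Type*} [Fintype C] [Fintype D] (ν : C → D → ℝ)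
    (h : A × C → B × D → ℝ) :
    weightedSum (fun (x : A × C) (y : B × D) => μ x.1 y.1 * ν x.2 y.2) h =
      weightedSum μ fun a b => weightedSum ν fun c d => h (a, c) (b, d) := by
  simp only [weightedSum, Fintype.sum_prod_type, mul_sum, mul_assoc]
  exact sum_congr rfl fun a _ => sum_comm

end weightedSum

/-- The covariance of `f` and `g` is at most `ρ` times the mean of their variances. -/
def CovBound {A B : Type*} [Fintype A] [Fintype B] (μ : A → B → ℝ) (ρ : ℝ) : Prop :=
  ∀ (f : A → ℝ) (g : B → ℝ),
    2 * (weightedSum μ (fun a b => f a * g b) -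
        weightedSum μ (fun a _ => f a) * weightedSum μ (fun _ b => g b)) ≤
      ρ * ((weightedSum μ (fun a _ => f a ^ 2) - weightedSum μ (fun a _ => f a) ^ 2) +
        (weightedSum μ (fun _ b => g b ^ 2) - weightedSum μ (fun _ b => g b) ^ 2))

section CovBound

variable {A B : Type*} [Fintype A] [Fintype B] {μ : A → B → ℝ} {ρ : ℝ}

theorem CovBound.equiv {A' B' : Type*} [Fintype A'] [Fintype B'] (hμ : CovBound μ ρ)
    (e₁ : A' ≃ A) (e₂ : B' ≃ B) : CovBound (fun a b => μ (e₁ a) (e₂ b)) ρ := by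
  intro f g
  have key := hμ (fun a => f (e₁.symm a)) (fun b => g (e₂.symm b))
  simp only [← weightedSum_equiv μ e₁ e₂, Equiv.symm_apply_apply] at key
  exact key

/-- Tensorization, by the laws of total covariance and total variance. -/
theorem CovBound.prod {C D : Type*} [Fintype C] [Fintype D] {ν : C → D → ℝ}
    (hnn : ∀ a b, 0 ≤ μ a b) (hμ : CovBound μ ρ) (hν : CovBound ν ρ) :
    CovBound (fun (x : A × C) (y : B × D) => μ x.1 y.1 * ν x.2 y.2) ρ := by
  intro f g
  have outer := hμ (fun a => weightedSum ν fun c _ => f (a, c))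
    (fun b => weightedSum ν fun _ d => g (b, d))
  have inner := weightedSum_mono hnn fun a b => hν (fun c => f (a, c)) (fun d => g (b, d))
  simp only [weightedSum_prod]
  simp only [weightedSum_const_mul, weightedSum_add, weightedSum_sub] at inner
  linarith

universe u v w

theorem CovBound.pi {ι : Type u} [Fintype ι] [DecidableEq ι]
    (Ω₁ : ι → Type v) (Ω₂ : ι → Type w) [∀ i, Fintype (Ω₁ i)] [∀ i, Fintype (Ω₂ i)]
    (μ : ∀ i, Ω₁ i → Ω₂ i → ℝ) (hnn : ∀ i a b, 0 ≤ μ i a b) (hμ : ∀ i, CovBound (μ i) ρ) :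
    CovBound (fun (x : ∀ i, Ω₁ i) (y : ∀ i, Ω₂ i) => ∏ i, μ i (x i) (y i)) ρ := by
  let P (κ : Type u) [Fintype κ] : Prop := ∀ (_ : DecidableEq κ) (Ω₁ : κ → Type v)
    (Ω₂ : κ → Type w) [∀ i, Fintype (Ω₁ i)] [∀ i, Fintype (Ω₂ i)] (μ : ∀ i, Ω₁ i → Ω₂ i → ℝ),
    (∀ i a b, 0 ≤ μ i a b) → (∀ i, CovBound (μ i) ρ) →
    CovBound (fun (x : ∀ i, Ω₁ i) (y : ∀ i, Ω₂ i) => ∏ i, μ i (x i) (y i)) ρ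
  suffices main : P ι from main inferInstance Ω₁ Ω₂ μ hnn hμ
  clear hμ hnn μ
  refine Fintype.induction_empty_option (P := P) ?_ ?_ ?_ ι
  · intro α β _ e ih _ Ω₁ Ω₂ _ _ μ hnn hμ
    classical
    let := Fintype.ofEquiv β e.symm
    have key := (ih inferInstance (fun i => Ω₁ (e i)) (fun i => Ω₂ (e i)) (fun i => μ (e i))
      (fun i => hnn (e i)) (fun i => hμ (e i))).equiv
      (Equiv.piCongrLeft Ω₁ e).symm (Equiv.piCongrLeft Ω₂ e).symm
    convert key using 3 with x y
    exact (e.prod_comp fun i => μ i (x i) (y i)).symm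
  · intro _ Ω₁ Ω₂ _ _ μ _ _ f g
    simp [weightedSum, sq]
  · intro α _ ih _ Ω₁ Ω₂ _ _ μ hnn hμ
    classical
    have key := ((hμ none).prod (hnn none) (ih inferInstance (fun i => Ω₁ (some i))
      (fun i => Ω₂ (some i)) (fun i => μ (some i)) (fun i => hnn (some i))
      (fun i => hμ (some i)))).equiv
      (Equiv.piOptionEquivProd (β := Ω₁)) (Equiv.piOptionEquivProd (β := Ω₂))
    convert key using 3 with x y
    exact Fintype.prod_option _

theorem corr_nonneg (μ : A → B → ℝ) : 0 ≤ corr μ := by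
  refine Real.sSup_nonneg ?_
  rintro x ⟨f, g, -, -, -, -, rfl⟩
  exact abs_nonneg _

theorem abs_weightedSum_le_corr (hnn : ∀ a b, 0 ≤ μ a b) (f : A → ℝ) (g : B → ℝ)
    (hf : weightedSum μ (fun a _ => f a) = 0) (hg : weightedSum μ (fun _ b => g b) = 0)
    (hf2 : weightedSum μ (fun a _ => f a ^ 2) ≤ 1)
    (hg2 : weightedSum μ (fun _ b => g b ^ 2) ≤ 1) :
    |weightedSum μ (fun a b => f a * g b)| ≤ corr μ := by
  refine le_csSup ⟨1, ?_⟩ ⟨f, g, hf, hg, hf2, hg2, by simp only [weightedSum, mul_assoc]⟩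
  rintro x ⟨f, g, -, -, hf2, hg2, rfl⟩
  change weightedSum μ (fun a _ => f a ^ 2) ≤ 1 at hf2
  change weightedSum μ (fun _ b => g b ^ 2) ≤ 1 at hg2
  simp only [mul_assoc]
  change |weightedSum μ (fun a b => f a * g b)| ≤ 1
  have upper : weightedSum μ (fun a b => 2 * (f a * g b)) ≤
      weightedSum μ (fun a b => f a ^ 2 + g b ^ 2) :=
    weightedSum_mono hnn fun a b => by nlinarith [sq_nonneg (f a - g b)]
  have lower : weightedSum μ (fun a b => -2 * (f a * g b)) ≤
      weightedSum μ (fun a b => f a ^ 2 + g b ^ 2) :=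
    weightedSum_mono hnn fun a b => by nlinarith [sq_nonneg (f a + g b)]
  rw [weightedSum_const_mul, weightedSum_add] at upper lower
  exact abs_le.2 ⟨by linarith, by linarith⟩

theorem covBound_of_corr_le (hnn : ∀ a b, 0 ≤ μ a b) (hsum : ∑ a, ∑ b, μ a b = 1)
    (hcorr : corr μ ≤ ρ) : CovBound μ ρ := by
  intro f g
  set m := weightedSum μ (fun a _ => f a) with hm
  set n := weightedSum μ (fun _ b => g b) with hn
  set V := weightedSum μ (fun a _ => f a ^ 2) - m ^ 2 with hV
  set W := weightedSum μ (fun _ b => g b ^ 2) - n ^ 2 with hW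
  have hf : weightedSum μ (fun a _ => f a - m) = 0 := by
    rw [weightedSum_sub, weightedSum_const hsum, hm, sub_self]
  have hg : weightedSum μ (fun _ b => g b - n) = 0 := by
    rw [weightedSum_sub, weightedSum_const hsum, hn, sub_self]
  have hf2 : weightedSum μ (fun a _ => (f a - m) ^ 2) = V := by
    have : (fun a (_ : B) => (f a - m) ^ 2) = fun a _ => (f a ^ 2 - 2 * m * f a) + m ^ 2 := by
      ext; ring
    rw [this, weightedSum_add, weightedSum_sub, weightedSum_const_mul, weightedSum_const hsum,
      ← hm, hV]
    ring
  have hg2 : weightedSum μ (fun _ b => (g b - n) ^ 2) = W := by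
    have : (fun (_ : A) b => (g b - n) ^ 2) = fun _ b => (g b ^ 2 - 2 * n * g b) + n ^ 2 := by
      ext; ring
    rw [this, weightedSum_add, weightedSum_sub, weightedSum_const_mul, weightedSum_const hsum,
      ← hn, hW]
    ring
  have hfg : weightedSum μ (fun a b => (f a - m) * (g b - n)) =
      weightedSum μ (fun a b => f a * g b) - m * n := by
    have : (fun a b => (f a - m) * (g b - n)) =
        fun a b => (f a * g b - n * f a) - (m * g b - m * n) := by
      ext; ring
    rw [this, weightedSum_sub, weightedSum_sub, weightedSum_sub, weightedSum_const_mul,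
      weightedSum_const_mul, weightedSum_const hsum, ← hm, ← hn]
    ring
  have hzero : weightedSum μ (fun _ _ => 0) = 0 := weightedSum_const hsum 0
  have hV0 : 0 ≤ V := by
    rw [← hf2, ← hzero]
    exact weightedSum_mono hnn fun a _ => sq_nonneg _
  have hW0 : 0 ≤ W := by
    rw [← hg2, ← hzero]
    exact weightedSum_mono hnn fun _ b => sq_nonneg _
  rw [← hfg]
  have hρ := (corr_nonneg μ).trans hcorr
  -- Normalizing by standard deviations enlarged by `ε` avoids the zero-variance case.
  have approx : ∀ ε > 0, 2 * weightedSum μ (fun a b => (f a - m) * (g b - n)) ≤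
      ρ * (V + W + 2 * ε) := by
    intro ε hε
    set s := √(V + ε) with hs
    set t := √(W + ε) with ht
    have hs0 : 0 < s := Real.sqrt_pos.2 (by linarith)
    have ht0 : 0 < t := Real.sqrt_pos.2 (by linarith)
    have hs2 : s ^ 2 = V + ε := Real.sq_sqrt (by linarith)
    have ht2 : t ^ 2 = W + ε := Real.sq_sqrt (by linarith)
    have key := abs_weightedSum_le_corr hnn (fun a => s⁻¹ * (f a - m)) (fun b => t⁻¹ * (g b - n))
      (by rw [weightedSum_const_mul, hf, mul_zero])
      (by rw [weightedSum_const_mul, hg, mul_zero])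
      (by
        simp only [mul_pow]
        rw [weightedSum_const_mul, hf2, inv_pow, hs2, inv_mul_le_one₀ (by linarith)]
        linarith)
      (by
        simp only [mul_pow]
        rw [weightedSum_const_mul, hg2, inv_pow, ht2, inv_mul_le_one₀ (by linarith)]
        linarith)
    simp only [mul_mul_mul_comm _ _ (t⁻¹), weightedSum_const_mul] at key
    replace key := (le_abs_self _).trans (key.trans hcorr)
    rw [← mul_inv, inv_mul_le_iff₀ (by positivity)] at key
    nlinarith [mul_nonneg hρ (sq_nonneg (s - t))]
  refine le_of_forall_pos_le_add fun ε hε => ?_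
  have hδ : 0 < ε / (2 * (ρ + 1)) := by positivity
  have hle : ρ * (2 * (ε / (2 * (ρ + 1)))) ≤ ε := by
    have : ρ * (2 * (ε / (2 * (ρ + 1)))) = ε * (ρ / (ρ + 1)) := by
      field_simp
    rw [this]
    exact mul_le_of_le_one_right hε.le ((div_le_one (by linarith)).2 (by linarith))
  have := approx _ hδ
  linarith

theorem CovBound.corr_le (hμ : CovBound μ ρ) (hρ : 0 ≤ ρ) : corr μ ≤ ρ := by
  refine Real.sSup_le ?_ hρ
  rintro x ⟨f, g, hf, hg, hf2, hg2, rfl⟩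
  change weightedSum μ (fun a _ => f a) = 0 at hf
  change weightedSum μ (fun _ b => g b) = 0 at hg
  change weightedSum μ (fun a _ => f a ^ 2) ≤ 1 at hf2
  change weightedSum μ (fun _ b => g b ^ 2) ≤ 1 at hg2
  simp only [mul_assoc]
  change |weightedSum μ (fun a b => f a * g b)| ≤ ρ
  have upper := hμ f g
  have lower := hμ (fun a => -1 * f a) g
  simp only [mul_pow, mul_assoc, weightedSum_const_mul, hf, hg] at upper lower
  have hle := mul_le_mul_of_nonneg_left (add_le_add hf2 hg2) hρ
  exact abs_le.2 ⟨by linarith, by linarith⟩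

end CovBound

/-- The correlation of a product of finite correlated probability spaces is at
most the maximum of the individual correlations. -/
theorem corr_prod_le_max {ι : Type*} [Fintype ι] [DecidableEq ι] [Nonempty ι]
    (Ω₁ Ω₂ : ι → Type*) [∀ i, Fintype (Ω₁ i)] [∀ i, Fintype (Ω₂ i)]
    (μ : ∀ i, Ω₁ i → Ω₂ i → ℝ)
    (hnn : ∀ i, ∀ a, ∀ b, 0 ≤ μ i a b)
    (hsum : ∀ i, (∑ a, ∑ b, μ i a b) = 1) :
    corr (fun (x : ∀ i, Ω₁ i) (y : ∀ i, Ω₂ i) => ∏ i, μ i (x i) (y i)) ≤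
      Finset.univ.sup' Finset.univ_nonempty (fun i => corr (μ i)) := by
  have hle : ∀ i, corr (μ i) ≤ Finset.univ.sup' Finset.univ_nonempty (fun i => corr (μ i)) :=
    fun i => Finset.le_sup' (fun i => corr (μ i)) (Finset.mem_univ i)
  refine CovBound.corr_le (CovBound.pi Ω₁ Ω₂ μ hnn fun i => ?_)
    ((corr_nonneg _).trans (hle (Classical.arbitrary ι)))
  exact covBound_of_corr_le (hnn i) (hsum i) (hle i)
end

section
/- For i = 1, …, n, let Ω_i be a finite set and let μ_i be a probability measure on Ω_i × Ω_i whose two marginals are equal; denote the common marginal by ν_i. Let f : ∏_{i=1}^n Ω_i → [0,1], and define F : ∏_{i=1}^n (Ω_i × Ω_i) → [0,1] by F((y_1,z_1),…,(y_n,z_n)) = f(y_1,…,y_n)·f(z_1,…,z_n). Then for every coordinate i, the influence of the i-th coordinate of F with respect to the product measure ∏_i μ_i satisfies Inf_i(F) ≤ 4·Inf_i(f), where Inf_i(f) is taken with respect to the product measure ∏_i ν_i. -/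
open Finset

/-- The influence of the `i`-th coordinate of `g` on the finite product
probability space with coordinate weights `lam i`:
`Inf_i(g) = E_{x_{-i}}[Var_{x_i}[g(x)]]`, written as the full expectation of
the squared deviation of `g` from its conditional mean over the `i`-th
coordinate. -/
noncomputable def influence {n : ℕ} {Ω : Fin n → Type*} [∀ i, Fintype (Ω i)]
    (lam : ∀ i, Ω i → ℝ) (g : (∀ i, Ω i) → ℝ) (i : Fin n) : ℝ :=
  ∑ x : ∀ j, Ω j, (∏ j, lam j (x j)) *
    (g x - ∑ a : Ω i, lam i a * g (Function.update x i a)) ^ 2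

/-- Resampling the `i`-th coordinate does not change an expectation. -/
lemma sum_prod_mul_sum_update {n : ℕ} {Ω : Fin n → Type*} [∀ i, Fintype (Ω i)]
    (lam : ∀ i, Ω i → ℝ) (i : Fin n) (hlam : ∑ a, lam i a = 1) (h : (∀ i, Ω i) → ℝ) :
    ∑ x : ∀ j, Ω j, (∏ j, lam j (x j)) * ∑ a, lam i a * h (Function.update x i a) =
      ∑ x : ∀ j, Ω j, (∏ j, lam j (x j)) * h x := by
  have hswap : ∑ p : (∀ j, Ω j) × Ω i,
      (∏ j, lam j (p.1 j)) * (lam i p.2 * h (Function.update p.1 i p.2)) =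
      ∑ p : (∀ j, Ω j) × Ω i, (∏ j, lam j (p.1 j)) * (lam i p.2 * h p.1) := by
    refine Finset.sum_nbij' (fun p => (Function.update p.1 i p.2, p.1 i))
      (fun p => (Function.update p.1 i p.2, p.1 i)) (by simp) (by simp) (by simp) (by simp) ?_
    rintro ⟨x, a⟩ -
    have hprod : ∏ j ∈ Finset.univ.erase i, lam j (Function.update x i a j) =
        ∏ j ∈ Finset.univ.erase i, lam j (x j) :=
      Finset.prod_congr rfl fun j hj => by
        rw [Function.update_of_ne (Finset.ne_of_mem_erase hj)]
    simp only [← Finset.mul_prod_erase Finset.univ _ (Finset.mem_univ i), hprod,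
      Function.update_self]
    ring
  simp only [Fintype.sum_prod_type, ← Finset.mul_sum, ← Finset.sum_mul, hlam, one_mul] at hswap
  exact hswap

/-- The conditional mean minimizes the expected squared deviation among the functions
that do not depend on the `i`-th coordinate. -/
lemma influence_le_sum_sq_sub {n : ℕ} {Ω : Fin n → Type*} [∀ i, Fintype (Ω i)]
    (lam : ∀ i, Ω i → ℝ) (hnn : ∀ i a, 0 ≤ lam i a) (i : Fin n) (hlam : ∑ a, lam i a = 1)
    (g c : (∀ i, Ω i) → ℝ) (hc : ∀ x a, c (Function.update x i a) = c x) :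
    influence lam g i ≤ ∑ x : ∀ j, Ω j, (∏ j, lam j (x j)) * (g x - c x) ^ 2 := by
  let m : (∀ j, Ω j) → ℝ := fun x => ∑ a, lam i a * g (Function.update x i a)
  have hm : ∀ x a, m (Function.update x i a) = m x := fun x a => by simp [m]
  have hcross : ∑ x : ∀ j, Ω j, (∏ j, lam j (x j)) * ((g x - m x) * (m x - c x)) = 0 := by
    rw [← sum_prod_mul_sum_update lam i hlam]
    refine Finset.sum_eq_zero fun x _ => ?_
    have hmean : ∑ a, lam i a * (g (Function.update x i a) - m x) = 0 := by
      simp only [mul_sub, Finset.sum_sub_distrib, ← Finset.sum_mul, hlam, one_mul]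
      exact sub_self _
    simp only [hm, hc, ← mul_assoc (lam i _), ← Finset.sum_mul, hmean, zero_mul, mul_zero]
  have hle : ∑ x : ∀ j, Ω j, ((∏ j, lam j (x j)) * (g x - m x) ^ 2 +
      2 * ((∏ j, lam j (x j)) * ((g x - m x) * (m x - c x)))) ≤
      ∑ x : ∀ j, Ω j, (∏ j, lam j (x j)) * (g x - c x) ^ 2 := by
    refine Finset.sum_le_sum fun x _ => ?_
    have hw : 0 ≤ ∏ j, lam j (x j) := Finset.prod_nonneg fun j _ => hnn j _
    nlinarith [mul_nonneg hw (sq_nonneg (m x - c x))]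
  rw [Finset.sum_add_distrib, ← Finset.mul_sum, hcross, mul_zero, add_zero] at hle
  exact hle

/-- The first marginal of a product of measures on `Ω i × Ω i` is the product of the
first marginals. -/
lemma sum_prod_mul_comp_fst {n : ℕ} {Ω : Fin n → Type*} [∀ i, Fintype (Ω i)]
    (μ : ∀ i, Ω i × Ω i → ℝ) (h : (∀ i, Ω i) → ℝ) :
    ∑ x : ∀ j, Ω j × Ω j, (∏ j, μ j (x j)) * h (fun j => (x j).1) =
      ∑ y : ∀ j, Ω j, (∏ j, ∑ b, μ j (y j, b)) * h y := by
  simp only [Finset.prod_univ_sum, Fintype.piFinset_univ, Finset.sum_mul]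
  rw [← Fintype.sum_prod_type'
    (f := fun y z : ∀ j, Ω j => (∏ j, μ j (y j, z j)) * h y)]
  exact Finset.sum_nbij' (fun x => (fun j => (x j).1, fun j => (x j).2))
    (fun p j => (p.1 j, p.2 j)) (by simp) (by simp) (by simp) (by simp) (by simp)

/-- The second marginal of a product of measures on `Ω i × Ω i` is the product of the
second marginals. -/
lemma sum_prod_mul_comp_snd {n : ℕ} {Ω : Fin n → Type*} [∀ i, Fintype (Ω i)]
    (μ : ∀ i, Ω i × Ω i → ℝ) (h : (∀ i, Ω i) → ℝ) :
    ∑ x : ∀ j, Ω j × Ω j, (∏ j, μ j (x j)) * h (fun j => (x j).2) =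
      ∑ y : ∀ j, Ω j, (∏ j, ∑ b, μ j (b, y j)) * h y := by
  refine Eq.trans ?_ (sum_prod_mul_comp_fst (fun j p => μ j p.swap) h)
  exact Finset.sum_nbij' (fun x j => (x j).swap) (fun x j => (x j).swap)
    (by simp) (by simp) (by simp) (by simp) (by simp)

lemma sq_mul_sub_mul_le {p q r s : ℝ} (hp : p ∈ Set.Icc (0 : ℝ) 1)
    (hs : s ∈ Set.Icc (0 : ℝ) 1) :
    (p * q - r * s) ^ 2 ≤ 2 * (p - r) ^ 2 + 2 * (q - s) ^ 2 := by
  have hp2 : p ^ 2 ≤ 1 := pow_le_one₀ hp.1 hp.2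
  have hs2 : s ^ 2 ≤ 1 := pow_le_one₀ hs.1 hs.2
  nlinarith [sq_nonneg (p * (q - s) - s * (p - r)),
    mul_nonneg (sub_nonneg.2 hp2) (sq_nonneg (q - s)),
    mul_nonneg (sub_nonneg.2 hs2) (sq_nonneg (p - r))]

/-- Let `μ i` be a probability measure on `Ω i × Ω i` with equal marginals, and
let `ν i` be the common marginal.  For `f : ∏ Ω i → [0,1]` and
`F((y₁,z₁),…,(y_n,z_n)) = f(y)·f(z)`, the influence of each coordinate
satisfies `Inf_i(F) ≤ 4·Inf_i(f)`, where `Inf_i(F)` is with respect to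
`∏ μ i` and `Inf_i(f)` with respect to `∏ ν i`. -/
theorem influence_prod_le {n : ℕ} (Ω : Fin n → Type*) [∀ i, Fintype (Ω i)]
    (μ : ∀ i, Ω i × Ω i → ℝ)
    (hnn : ∀ i ab, 0 ≤ μ i ab)
    (hsum : ∀ i, (∑ ab : Ω i × Ω i, μ i ab) = 1)
    (hmarg : ∀ i (a : Ω i), (∑ b, μ i (a, b)) = ∑ b, μ i (b, a))
    (f : (∀ i, Ω i) → ℝ) (hf : ∀ x, f x ∈ Set.Icc (0 : ℝ) 1) (i : Fin n) :
    influence (Ω := fun j => Ω j × Ω j) (fun j => μ j)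
        (fun x => f (fun j => (x j).1) * f (fun j => (x j).2)) i ≤
      4 * influence (fun j a => ∑ b, μ j (a, b)) f i := by
  let ν : ∀ j, Ω j → ℝ := fun j a => ∑ b, μ j (a, b)
  let m : (∀ j, Ω j) → ℝ := fun x => ∑ a, ν i a * f (Function.update x i a)
  have hν : ∀ a, 0 ≤ ν i a := fun a => Finset.sum_nonneg fun b _ => hnn i _
  have hν1 : ∑ a, ν i a = 1 := by rw [← hsum i, Fintype.sum_prod_type]
  have hm : ∀ x, m x ∈ Set.Icc (0 : ℝ) 1 := fun x =>
    ⟨Finset.sum_nonneg fun a _ => mul_nonneg (hν a) (hf _).1,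
      (Finset.sum_le_sum fun a _ => mul_le_of_le_one_right (hν a) (hf _).2).trans_eq hν1⟩
  have hfst : ∀ (x : ∀ j, Ω j × Ω j) a,
      (fun j => (Function.update x i a j).1) = Function.update (fun j => (x j).1) i a.1 :=
    fun x a => funext fun j => Function.apply_update (fun _ => Prod.fst) x i a j
  have hsnd : ∀ (x : ∀ j, Ω j × Ω j) a,
      (fun j => (Function.update x i a j).2) = Function.update (fun j => (x j).2) i a.2 :=
    fun x a => funext fun j => Function.apply_update (fun _ => Prod.snd) x i a j
  have hupd : ∀ x a, m (Function.update x i a) = m x := fun x a => by simp [m]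
  have h1 := sum_prod_mul_comp_fst μ fun y => (f y - m y) ^ 2
  have h2 := sum_prod_mul_comp_snd μ fun y => (f y - m y) ^ 2
  simp only [← hmarg] at h2
  calc
    _ ≤ ∑ x : ∀ j, Ω j × Ω j, (∏ j, μ j (x j)) *
        (f (fun j => (x j).1) * f (fun j => (x j).2) -
          m (fun j => (x j).1) * m (fun j => (x j).2)) ^ 2 :=
      influence_le_sum_sq_sub (Ω := fun j => Ω j × Ω j) μ hnn i (hsum i) _
        (fun x => m (fun j => (x j).1) * m (fun j => (x j).2))
        fun x a => by simp only [hfst, hsnd, hupd]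
    _ ≤ ∑ x : ∀ j, Ω j × Ω j,
        (2 * ((∏ j, μ j (x j)) * (f (fun j => (x j).1) - m (fun j => (x j).1)) ^ 2) +
          2 * ((∏ j, μ j (x j)) * (f (fun j => (x j).2) - m (fun j => (x j).2)) ^ 2)) := by
      refine Finset.sum_le_sum fun x _ => ?_
      have hw : 0 ≤ ∏ j, μ j (x j) := Finset.prod_nonneg fun j _ => hnn j _
      refine (mul_le_mul_of_nonneg_left (sq_mul_sub_mul_le (hf _) (hm _)) hw).trans_eq ?_
      ring
    _ = 4 * influence ν f i := by
      rw [Finset.sum_add_distrib, ← Finset.mul_sum, ← Finset.mul_sum, h1, h2, ← add_mul]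
      norm_num [influence, ν, m]
end

section
/- Let R_1, R_2 be finite sets, let s ≥ 1 and T ≥ 1 be real parameters, and let π be a random map from R_2 to R_1 such that for every pair of distinct elements i, j ∈ R_2, Pr[π(i) = π(j)] ≤ 1/T. Let f : {−1,1}^{R_2} → ℝ satisfy Σ_{α ⊆ R_2} f̂_α² ≤ 1. Say that α ⊆ R_2 is shattered by π if |π(α)| = |α|. For each outcome of π, define f_2^π := Σ_{α : |α| < s and α not shattered by π} f̂_α χ_α. Then E_π[‖f_2^π‖_2] ≤ s/√T. -/
open Finset

/-- The character `χ_α(x) = ∏_{j ∈ α} x_j` on the Boolean cube, with `Bool`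
encoding `{−1,1}` via `true ↦ 1`, `false ↦ −1`. -/
def chiChar {R : Type*} (α : Finset R) (x : R → Bool) : ℝ :=
  ∏ j ∈ α, (if x j then (1 : ℝ) else -1)

/-- The Fourier coefficient `f̂_α = E[f·χ_α]` under the uniform measure. -/
noncomputable def fcoef {R : Type*} [Fintype R] [DecidableEq R]
    (f : (R → Bool) → ℝ) (α : Finset R) : ℝ :=
  (∑ x : R → Bool, f x * chiChar α x) / 2 ^ Fintype.card R

/-- The `L²` norm `‖f‖₂ = (E[f²])^{1/2}` under the uniform measure. -/
noncomputable def norm2 {R : Type*} [Fintype R] [DecidableEq R]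
    (f : (R → Bool) → ℝ) : ℝ :=
  Real.sqrt ((∑ x : R → Bool, f x ^ 2) / 2 ^ Fintype.card R)

/-- Orthogonality of the characters on the Boolean cube. -/
theorem sum_chiChar_mul_chiChar {R : Type*} [Fintype R] [DecidableEq R] (α β : Finset R) :
    ∑ x : R → Bool, chiChar α x * chiChar β x = if α = β then 2 ^ Fintype.card R else 0 := by
  have factor (x : R → Bool) : chiChar α x * chiChar β x =
      ∏ j, ((if j ∈ α then (if x j then (1 : ℝ) else -1) else 1) *
        (if j ∈ β then (if x j then (1 : ℝ) else -1) else 1)) := by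
    simp only [chiChar, Finset.prod_mul_distrib, Finset.prod_ite_mem, Finset.univ_inter]
  simp_rw [factor]
  rw [← Fintype.prod_sum (fun (j : R) (b : Bool) =>
    (if j ∈ α then (if b then (1 : ℝ) else -1) else 1) *
      (if j ∈ β then (if b then (1 : ℝ) else -1) else 1))]
  split_ifs with h
  · subst h
    rw [← Finset.card_univ, ← Finset.prod_const]
    refine Finset.prod_congr rfl fun j _ => ?_
    by_cases hj : j ∈ α <;> norm_num [hj]
  · obtain ⟨j, hj⟩ : ∃ j, ¬(j ∈ α ↔ j ∈ β) := by
      by_contra! hc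
      exact h (Finset.ext hc)
    refine Finset.prod_eq_zero (Finset.mem_univ j) ?_
    by_cases hα : j ∈ α <;> by_cases hβ : j ∈ β <;> simp_all

theorem norm2_nonneg {R : Type*} [Fintype R] [DecidableEq R] (f : (R → Bool) → ℝ) :
    0 ≤ norm2 f :=
  Real.sqrt_nonneg _

/-- Parseval's identity for a function given by its Fourier expansion. -/
theorem norm2_sum_chiChar_sq {R : Type*} [Fintype R] [DecidableEq R]
    (A : Finset (Finset R)) (c : Finset R → ℝ) :
    norm2 (fun x => ∑ α ∈ A, c α * chiChar α x) ^ 2 = ∑ α ∈ A, c α ^ 2 := by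
  rw [norm2, Real.sq_sqrt (by positivity), div_eq_iff (by positivity)]
  calc ∑ x : R → Bool, (∑ α ∈ A, c α * chiChar α x) ^ 2
      = ∑ α ∈ A, ∑ β ∈ A, c α * c β * ∑ x : R → Bool, chiChar α x * chiChar β x := by
        simp_rw [sq, Finset.sum_mul_sum, Finset.mul_sum]
        rw [Finset.sum_comm]
        refine Finset.sum_congr rfl fun α _ => ?_
        rw [Finset.sum_comm]
        refine Finset.sum_congr rfl fun β _ => Finset.sum_congr rfl fun x _ => ?_
        ring
    _ = (∑ α ∈ A, c α ^ 2) * 2 ^ Fintype.card R := by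
        rw [Finset.sum_mul]
        refine Finset.sum_congr rfl fun α hα => ?_
        simp [sum_chiChar_mul_chiChar, hα, sq]

/-- Union bound: a set of size `k` fails to be shattered with probability at most `k² ε` if any
two distinct elements collide with probability at most `ε`. -/
theorem sum_not_shattered_le {R₁ R₂ : Type*}
    [Fintype R₂] [DecidableEq R₂] [Fintype R₁] [DecidableEq R₁]
    (p : (R₂ → R₁) → ℝ) (hp0 : ∀ π, 0 ≤ p π) {ε : ℝ} (hε : 0 ≤ ε)
    (hcol : ∀ i j : R₂, i ≠ j → ∑ π : R₂ → R₁ with π i = π j, p π ≤ ε) (α : Finset R₂) :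
    ∑ π : R₂ → R₁ with (α.image π).card ≠ α.card, p π ≤ (α.card : ℝ) ^ 2 * ε := by
  calc ∑ π : R₂ → R₁ with (α.image π).card ≠ α.card, p π
      ≤ ∑ π : R₂ → R₁, ∑ q ∈ α.offDiag, if π q.1 = π q.2 then p π else 0 := by
        rw [Finset.sum_filter]
        refine Finset.sum_le_sum fun π _ => ?_
        have hterm (q : R₂ × R₂) : 0 ≤ if π q.1 = π q.2 then p π else 0 := by
          split_ifs
          exacts [hp0 π, le_rfl]
        split_ifs with hπ
        · rw [Ne, Finset.card_image_iff, Set.InjOn] at hπ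
          push Not at hπ
          obtain ⟨i, hi, j, hj, hij, hne⟩ := hπ
          refine le_trans (by simp [hij]) (Finset.single_le_sum (fun q _ => hterm q)
            (Finset.mem_offDiag.2 ⟨hi, hj, hne⟩ : (i, j) ∈ α.offDiag))
        · exact Finset.sum_nonneg fun q _ => hterm q
    _ = ∑ q ∈ α.offDiag, ∑ π : R₂ → R₁ with π q.1 = π q.2, p π := by
        rw [Finset.sum_comm]
        simp_rw [Finset.sum_filter]
    _ ≤ ∑ q ∈ α.offDiag, ε :=
        Finset.sum_le_sum fun q hq => hcol _ _ (Finset.mem_offDiag.1 hq).2.2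
    _ ≤ (α.card : ℝ) ^ 2 * ε := by
        rw [Finset.sum_const, nsmul_eq_mul]
        gcongr
        exact_mod_cast (by rw [Finset.offDiag_card, sq]; exact Nat.sub_le _ _ :
          α.offDiag.card ≤ α.card ^ 2)

/-- Let `π` be a random map from `R₂` to `R₁` (with distribution `p`) such that
any two distinct coordinates collide with probability at most `1/T`, and let
`f : {−1,1}^{R₂} → ℝ` with `Σ_α f̂_α² ≤ 1`.  With
`f₂^π = Σ_{|α| < s, α not shattered by π} f̂_α χ_α`, one has
`E_π[‖f₂^π‖₂] ≤ s/√T`.  (`α` is shattered by `π` if `|π(α)| = |α|`.) -/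
theorem expected_norm_unshattered_le {R₁ R₂ : Type*}
    [Fintype R₂] [DecidableEq R₂] [Fintype R₁] [DecidableEq R₁]
    (s T : ℝ) (hs : 1 ≤ s) (hT : 1 ≤ T)
    (p : (R₂ → R₁) → ℝ) (hp0 : ∀ π, 0 ≤ p π) (hp1 : (∑ π : R₂ → R₁, p π) = 1)
    (hcol : ∀ i j : R₂, i ≠ j →
      (∑ π ∈ Finset.univ.filter (fun π : R₂ → R₁ => π i = π j), p π) ≤ 1 / T)
    (f : (R₂ → Bool) → ℝ) (hf : (∑ α : Finset R₂, fcoef f α ^ 2) ≤ 1) :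
    (∑ π : R₂ → R₁, p π * norm2 (fun x =>
        ∑ α ∈ Finset.univ.filter
          (fun α : Finset R₂ => (α.card : ℝ) < s ∧ (α.image π).card ≠ α.card),
          fcoef f α * chiChar α x)) ≤ s / Real.sqrt T := by
  have hT0 : 0 < T := by linarith
  have hsqrt : s / √T = √(s ^ 2 / T) := by
    rw [Real.sqrt_div (sq_nonneg s), Real.sqrt_sq (by linarith)]
  rw [hsqrt]
  refine Real.le_sqrt_of_sq_le ?_
  refine (Real.pow_arith_mean_le_arith_mean_pow Finset.univ p _ (fun π _ => hp0 π) hp1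
    (fun π _ => norm2_nonneg _) 2).trans ?_
  simp_rw [norm2_sum_chiChar_sq, Finset.sum_filter, Finset.mul_sum]
  rw [Finset.sum_comm]
  calc _ ≤ ∑ α : Finset R₂, fcoef f α ^ 2 * (s ^ 2 / T) := by
        refine Finset.sum_le_sum fun α _ => ?_
        by_cases hα : (α.card : ℝ) < s
        · calc _ = fcoef f α ^ 2 * ∑ π : R₂ → R₁ with (α.image π).card ≠ α.card, p π := by
                rw [Finset.sum_filter, Finset.mul_sum]
                refine Finset.sum_congr rfl fun π _ => ?_
                simp only [hα, true_and]
                split_ifs <;> ring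
            _ ≤ fcoef f α ^ 2 * ((α.card : ℝ) ^ 2 * (1 / T)) := by
                gcongr
                exact sum_not_shattered_le p hp0 (by positivity) hcol α
            _ ≤ fcoef f α ^ 2 * (s ^ 2 / T) := by
                rw [mul_one_div]
                gcongr
        · simp only [hα, false_and, if_false, mul_zero, Finset.sum_const_zero]
          positivity
    _ ≤ s ^ 2 / T := by
        rw [← Finset.sum_mul]
        exact mul_le_of_le_one_left (by positivity) hf
end

section
/- (Reverse hypercontractive inequality, two-set form) Let A, B ⊆ {−1,1}^n have relative densities |A|/2^n = e^{−a²/2} and |B|/2^n = e^{−b²/2} with a, b ≥ 0, and let ρ ∈ (0,1). Let y be uniform on {−1,1}^n and let y' be a ρ-correlated copy of y. Then Pr[y ∈ A and y' ∈ B] ≥ exp[−(1/2)·(a² + b² + 2ρab)/(1 − ρ²)]. -/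
open Finset

/-- The probability of the pair `(y, y')` where `y` is uniform on `{−1,1}^n`
(encoded by `Bool`) and `y'` is a `ρ`-correlated copy of `y`: coordinatewise,
`y'_i = y_i` with probability `(1+ρ)/2` and `y'_i = −y_i` with probability
`(1−ρ)/2`, independently. -/
noncomputable def corrPairProb (n : ℕ) (ρ : ℝ) (y y' : Fin n → Bool) : ℝ :=
  (1 / 2 ^ n) * ∏ i, (if y i = y' i then (1 + ρ) / 2 else (1 - ρ) / 2)

/-- Convexity of `sinh` on `[0, ∞)`, in the form of superlinear scaling. -/
lemma mul_sinh_le_sinh_mul {s h : ℝ} (hs : 1 ≤ s) (hh : 0 ≤ h) :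
    s * Real.sinh h ≤ Real.sinh (s * h) := by
  have hd : ∀ x, HasDerivAt (fun x => Real.sinh (s * x) - s * Real.sinh x)
      (Real.cosh (s * x) * s - s * Real.cosh x) x := fun x => by
    have h1 : HasDerivAt (fun x : ℝ => s * x) s x := by
      simpa using (hasDerivAt_id x).const_mul s
    exact h1.sinh.sub ((Real.hasDerivAt_sinh x).const_mul s)
  have hmono : MonotoneOn (fun x => Real.sinh (s * x) - s * Real.sinh x) (Set.Ici 0) := by
    refine monotoneOn_of_deriv_nonneg (convex_Ici 0)
      (fun x _ => (hd x).continuousAt.continuousWithinAt)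
      (fun x _ => (hd x).differentiableAt.differentiableWithinAt) fun x hx => ?_
    rw [interior_Ici, Set.mem_Ioi] at hx
    rw [(hd x).deriv]
    have : Real.cosh x ≤ Real.cosh (s * x) := by
      rw [Real.cosh_le_cosh, abs_of_pos hx, abs_of_nonneg (by positivity)]
      nlinarith
    nlinarith
  simpa using hmono Set.self_mem_Ici hh hh

lemma mul_sub_mul_rpow_le_rpow_sub_rpow {s X Y : ℝ} (hs : 1 ≤ s) (hY : 0 < Y) (hYX : Y ≤ X) :
    s * (X - Y) * (X * Y) ^ ((s - 1) / 2) ≤ X ^ s - Y ^ s := by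
  have hX : 0 < X := hY.trans_le hYX
  obtain ⟨α, rfl⟩ : ∃ α, X = Real.exp α := ⟨_, (Real.exp_log hX).symm⟩
  obtain ⟨β, rfl⟩ : ∃ β, Y = Real.exp β := ⟨_, (Real.exp_log hY).symm⟩
  rw [Real.exp_le_exp] at hYX
  have key := mul_sinh_le_sinh_mul hs (show 0 ≤ (α - β) / 2 by linarith)
  have key' := mul_le_mul_of_nonneg_right key (Real.exp_pos (s * ((α + β) / 2))).le
  rw [← Real.exp_add, ← Real.exp_mul, ← Real.exp_mul, ← Real.exp_mul]
  have e1 : s * Real.sinh ((α - β) / 2) * Real.exp (s * ((α + β) / 2)) * 2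
      = s * (Real.exp α - Real.exp β) * Real.exp ((α + β) * ((s - 1) / 2)) := by
    rw [Real.sinh_eq]
    have h1 : Real.exp ((α - β) / 2) * Real.exp (s * ((α + β) / 2))
        = Real.exp α * Real.exp ((α + β) * ((s - 1) / 2)) := by
      rw [← Real.exp_add, ← Real.exp_add]; ring_nf
    have h2 : Real.exp (-((α - β) / 2)) * Real.exp (s * ((α + β) / 2))
        = Real.exp β * Real.exp ((α + β) * ((s - 1) / 2)) := by
      rw [← Real.exp_add, ← Real.exp_add]; ring_nf
    linear_combination s * h1 - s * h2
  have e2 : Real.sinh (s * ((α - β) / 2)) * Real.exp (s * ((α + β) / 2)) * 2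
      = Real.exp (α * s) - Real.exp (β * s) := by
    rw [Real.sinh_eq]
    have h1 : Real.exp (s * ((α - β) / 2)) * Real.exp (s * ((α + β) / 2))
        = Real.exp (α * s) := by
      rw [← Real.exp_add]; ring_nf
    have h2 : Real.exp (-(s * ((α - β) / 2))) * Real.exp (s * ((α + β) / 2))
        = Real.exp (β * s) := by
      rw [← Real.exp_add]; ring_nf
    linear_combination h1 - h2
  linarith

lemma mul_sub_mul_rpow_le {s X Y : ℝ} (hs : 1 ≤ s) (hY : 0 < Y) (hYX : Y ≤ X) :
    2 * s * (X - Y) * (X * Y) ^ (s - 1) ≤ (X ^ s - Y ^ s) * (X ^ (s - 1) + Y ^ (s - 1)) := by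
  have hX : 0 < X := hY.trans_le hYX
  have h1 := mul_sub_mul_rpow_le_rpow_sub_rpow hs hY hYX
  have hsq : ∀ Z : ℝ, 0 < Z → Z ^ (s - 1) = Z ^ ((s - 1) / 2) * Z ^ ((s - 1) / 2) := fun Z hZ => by
    rw [← Real.rpow_add hZ]; ring_nf
  have h2 : 2 * (X * Y) ^ ((s - 1) / 2) ≤ X ^ (s - 1) + Y ^ (s - 1) := by
    rw [Real.mul_rpow hX.le hY.le, hsq X hX, hsq Y hY]
    nlinarith [sq_nonneg (X ^ ((s - 1) / 2) - Y ^ ((s - 1) / 2))]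
  have h0 : 0 ≤ s * (X - Y) * (X * Y) ^ ((s - 1) / 2) :=
    mul_nonneg (mul_nonneg (by linarith) (by linarith)) (by positivity)
  calc 2 * s * (X - Y) * (X * Y) ^ (s - 1)
      = (s * (X - Y) * (X * Y) ^ ((s - 1) / 2)) * (2 * (X * Y) ^ ((s - 1) / 2)) := by
        rw [hsq (X * Y) (by positivity)]; ring
    _ ≤ _ := mul_le_mul h1 h2 (by positivity) (h0.trans h1)

lemma one_le_rpow_mul_add_sq_div {s u : ℝ} (hs : 1 ≤ s) (hu0 : 0 ≤ u) (hu1 : u ≤ 1) :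
    1 ≤ (1 + u) ^ s * (1 - u) ^ s + (((1 + u) ^ s - (1 - u) ^ s) / 2) ^ 2 / s := by
  have hs0 : 0 < s := by linarith
  have hmono : MonotoneOn (fun u : ℝ => (1 + u) ^ s * (1 - u) ^ s +
      (((1 + u) ^ s - (1 - u) ^ s) / 2) ^ 2 / s) (Set.Icc 0 1) := by
    have hd : ∀ x ∈ Set.Ioo (0 : ℝ) 1, HasDerivAt (fun u : ℝ => (1 + u) ^ s * (1 - u) ^ s +
        (((1 + u) ^ s - (1 - u) ^ s) / 2) ^ 2 / s)
        ((s * (1 + x) ^ (s - 1)) * (1 - x) ^ s + (1 + x) ^ s * (-(s * (1 - x) ^ (s - 1))) +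
          2 * (((1 + x) ^ s - (1 - x) ^ s) / 2) *
            ((s * (1 + x) ^ (s - 1) + s * (1 - x) ^ (s - 1)) / 2) / s) x := by
      rintro x ⟨hx0, hx1⟩
      have hp : HasDerivAt (fun u : ℝ => (1 + u) ^ s) (s * (1 + x) ^ (s - 1)) x := by
        have := ((hasDerivAt_id x).const_add 1).rpow_const (p := s) (Or.inr hs)
        simpa using this
      have hm : HasDerivAt (fun u : ℝ => (1 - u) ^ s) (-(s * (1 - x) ^ (s - 1))) x := by
        have := ((hasDerivAt_id x).const_sub 1).rpow_const (p := s) (Or.inr hs)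
        simpa using this
      refine ((hp.mul hm).add ((((hp.sub hm).div_const 2).pow 2).div_const s)).congr_deriv ?_
      simp
    refine monotoneOn_of_deriv_nonneg (convex_Icc 0 1) ?_ ?_ ?_
    · have h1 : Continuous fun u : ℝ => (1 + u) ^ s :=
        (continuous_const.add continuous_id).rpow_const fun _ => Or.inr hs0.le
      have h2 : Continuous fun u : ℝ => (1 - u) ^ s :=
        (continuous_const.sub continuous_id).rpow_const fun _ => Or.inr hs0.le
      exact Continuous.continuousOn (by fun_prop)
    · rw [interior_Icc]
      exact fun x hx => (hd x hx).differentiableAt.differentiableWithinAt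
    · rw [interior_Icc]
      intro x hx
      rw [(hd x hx).deriv]
      obtain ⟨hx0, hx1⟩ := hx
      have hX : 0 < 1 + x := by linarith
      have hY : 0 < 1 - x := by linarith
      have key := mul_sub_mul_rpow_le hs hY (show 1 - x ≤ 1 + x by linarith)
      rw [Real.mul_rpow hX.le hY.le] at key
      have e : ∀ Z : ℝ, 0 < Z → Z ^ s = Z ^ (s - 1) * Z := fun Z hZ => by
        rw [Real.rpow_sub_one hZ.ne']; field_simp
      have e3 : 2 * (((1 + x) ^ s - (1 - x) ^ s) / 2) *
            ((s * (1 + x) ^ (s - 1) + s * (1 - x) ^ (s - 1)) / 2) / s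
          = ((1 + x) ^ s - (1 - x) ^ s) * ((1 + x) ^ (s - 1) + (1 - x) ^ (s - 1)) / 2 := by
        field_simp
      have e4 : (s * (1 + x) ^ (s - 1)) * (1 - x) ^ s + (1 + x) ^ s * (-(s * (1 - x) ^ (s - 1)))
          = - (2 * s * ((1 + x) - (1 - x)) * ((1 + x) ^ (s - 1) * (1 - x) ^ (s - 1))) / 2 := by
        rw [e _ hX, e _ hY]; ring
      rw [e3, e4]
      linarith
  have := hmono (Set.left_mem_Icc.2 zero_le_one) ⟨hu0, hu1⟩ hu0
  simpa using this

/-- The one-function two-point inequality: the mean of `X ^ s, Y ^ s` dominates the `s`-th power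
of the mean, with a quadratic gain in the difference. -/
lemma rpow_mean_sq_add_le {s X Y : ℝ} (hs : 1 ≤ s) (hX : 0 ≤ X) (hY : 0 ≤ Y) :
    (((X + Y) / 2) ^ s) ^ 2 + (1 - 1 / s) * ((X ^ s - Y ^ s) / 2) ^ 2
      ≤ ((X ^ s + Y ^ s) / 2) ^ 2 := by
  wlog hYX : Y ≤ X generalizing X Y
  · have := this hY hX (le_of_not_ge hYX)
    rw [add_comm Y X, add_comm (Y ^ s)] at this
    linear_combination this
  have hs0 : 0 < s := by linarith
  rcases hX.eq_or_lt with h0 | hXpos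
  · have hY0 : Y = 0 := by linarith
    simp [← h0, hY0, Real.zero_rpow hs0.ne']
  have hM : 0 < (X + Y) / 2 := by linarith
  have hsum : X + Y ≠ 0 := by linarith
  have hu0 : 0 ≤ (X - Y) / (X + Y) := div_nonneg (by linarith) (by linarith)
  have hu1 : (X - Y) / (X + Y) ≤ 1 := by rw [div_le_one (by linarith)]; linarith
  have key := one_le_rpow_mul_add_sq_div hs hu0 hu1
  set u := (X - Y) / (X + Y) with hu
  set M := (X + Y) / 2 with hMdef
  have hXe : X = M * (1 + u) := by rw [hu, hMdef]; field_simp; ring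
  have hYe : Y = M * (1 - u) := by rw [hu, hMdef]; field_simp; ring
  have hXs : X ^ s = M ^ s * (1 + u) ^ s := by
    conv_lhs => rw [hXe]
    exact Real.mul_rpow hM.le (by linarith)
  have hYs : Y ^ s = M ^ s * (1 - u) ^ s := by
    conv_lhs => rw [hYe]
    exact Real.mul_rpow hM.le (by linarith)
  rw [hXs, hYs]
  have := mul_le_mul_of_nonneg_left key (sq_nonneg (M ^ s))
  linear_combination this

/-- The two-function two-point inequality. -/
lemma two_point_reverse_hypercontractive {s t ρ : ℝ} (hs : 1 ≤ s) (ht : 1 ≤ t) (hρ : 0 ≤ ρ)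
    (hst : ρ ^ 2 = (1 - 1 / s) * (1 - 1 / t)) {x₀ x₁ y₀ y₁ : ℝ}
    (hx₀ : 0 ≤ x₀) (hx₁ : 0 ≤ x₁) (hy₀ : 0 ≤ y₀) (hy₁ : 0 ≤ y₁) :
    ((x₀ + x₁) / 2) ^ s * ((y₀ + y₁) / 2) ^ t ≤
      (1 + ρ) / 4 * (x₀ ^ s * y₀ ^ t + x₁ ^ s * y₁ ^ t) +
        (1 - ρ) / 4 * (x₀ ^ s * y₁ ^ t + x₁ ^ s * y₀ ^ t) := by
  have h1 := rpow_mean_sq_add_le hs hx₀ hx₁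
  have h2 := rpow_mean_sq_add_le ht hy₀ hy₁
  have hκ : 0 ≤ 1 - 1 / s := by
    rw [sub_nonneg, div_le_one (by linarith)]; exact hs
  have hκ' : 0 ≤ 1 - 1 / t := by
    rw [sub_nonneg, div_le_one (by linarith)]; exact ht
  have hM : 0 ≤ ((x₀ + x₁) / 2) ^ s := by positivity
  have hM' : 0 ≤ ((y₀ + y₁) / 2) ^ t := by positivity
  have hC : 0 ≤ (x₀ ^ s + x₁ ^ s) / 2 := by positivity
  have hC' : 0 ≤ (y₀ ^ t + y₁ ^ t) / 2 := by positivity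
  have hgoal : (1 + ρ) / 4 * (x₀ ^ s * y₀ ^ t + x₁ ^ s * y₁ ^ t) +
        (1 - ρ) / 4 * (x₀ ^ s * y₁ ^ t + x₁ ^ s * y₀ ^ t)
      = (x₀ ^ s + x₁ ^ s) / 2 * ((y₀ ^ t + y₁ ^ t) / 2) +
        ρ * ((x₀ ^ s - x₁ ^ s) / 2 * ((y₀ ^ t - y₁ ^ t) / 2)) := by ring
  rw [hgoal]
  generalize ((x₀ + x₁) / 2) ^ s = M at *
  generalize ((y₀ + y₁) / 2) ^ t = M' at *
  generalize (x₀ ^ s + x₁ ^ s) / 2 = C at *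
  generalize (y₀ ^ t + y₁ ^ t) / 2 = C' at *
  generalize (x₀ ^ s - x₁ ^ s) / 2 = S at *
  generalize (y₀ ^ t - y₁ ^ t) / 2 = S' at *
  generalize 1 - 1 / s = κ at *
  generalize 1 - 1 / t = κ' at *
  clear hgoal
  have hprod := mul_le_mul h1 h2 (by positivity) (sq_nonneg C)
  obtain ⟨r, hr0, rfl⟩ : ∃ r, 0 ≤ r ∧ κ = r ^ 2 := ⟨√κ, by positivity, (Real.sq_sqrt hκ).symm⟩
  obtain ⟨r', hr0', rfl⟩ : ∃ r, 0 ≤ r ∧ κ' = r ^ 2 :=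
    ⟨√κ', by positivity, (Real.sq_sqrt hκ').symm⟩
  have hρr : ρ = r * r' := by
    rw [← mul_pow] at hst
    exact (pow_left_inj₀ hρ (by positivity) two_ne_zero).1 hst
  subst hρr
  have hsq : (M * M' - r * r' * (S * S')) ^ 2 ≤ (C * C') ^ 2 := by
    nlinarith [sq_nonneg (M * (r' * S') + M' * (r * S))]
  have := abs_le_of_sq_le_sq hsq (by positivity)
  linarith [le_of_abs_le this]

lemma sum_bool_pi_succ {n : ℕ} (F : (Fin (n + 1) → Bool) → ℝ) :
    ∑ y, F y = ∑ y : Fin n → Bool, F (Fin.cons true y) +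
      ∑ y : Fin n → Bool, F (Fin.cons false y) := by
  rw [← (Fin.consEquiv fun _ : Fin (n + 1) => Bool).sum_comp F, Fintype.sum_prod_type,
    Fintype.sum_bool]
  rfl

lemma corrPairProb_cons (n : ℕ) (ρ : ℝ) (b c : Bool) (y z : Fin n → Bool) :
    corrPairProb (n + 1) ρ (Fin.cons b y) (Fin.cons c z) =
      (if b = c then (1 + ρ) / 4 else (1 - ρ) / 4) * corrPairProb n ρ y z := by
  unfold corrPairProb
  rw [Fin.prod_univ_succ]
  simp only [Fin.cons_zero, Fin.cons_succ, pow_succ]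
  split_ifs <;> field_simp <;> ring

lemma corrPairProb_comm (n : ℕ) (ρ : ℝ) (y z : Fin n → Bool) :
    corrPairProb n ρ y z = corrPairProb n ρ z y := by
  simp only [corrPairProb, eq_comm]

lemma sum_corrPairProb (n : ℕ) (ρ : ℝ) (y : Fin n → Bool) :
    ∑ z, corrPairProb n ρ y z = 1 / 2 ^ n := by
  simp only [corrPairProb]
  rw [← Finset.mul_sum, ← Fintype.piFinset_univ,
    ← Finset.prod_univ_sum (fun _ => Finset.univ)
      (fun i b => if y i = b then (1 + ρ) / 2 else (1 - ρ) / 2)]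
  rw [Finset.prod_eq_one, mul_one]
  intro i _
  rw [Fintype.sum_bool]
  cases y i <;> simp <;> ring

/-- The two-function reverse hypercontractive inequality on the discrete cube. -/
theorem reverse_hypercontractive_two_functions {s t ρ : ℝ} (hs : 1 ≤ s) (ht : 1 ≤ t)
    (hρ : 0 ≤ ρ) (hρ1 : ρ ≤ 1) (hst : ρ ^ 2 = (1 - 1 / s) * (1 - 1 / t)) (n : ℕ)
    (f g : (Fin n → Bool) → ℝ) (hf : ∀ y, 0 ≤ f y) (hg : ∀ y, 0 ≤ g y) :
    ((∑ y, f y) / 2 ^ n) ^ s * ((∑ y, g y) / 2 ^ n) ^ t ≤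
      ∑ y, ∑ z, corrPairProb n ρ y z * (f y ^ s * g z ^ t) := by
  induction n with
  | zero => simp [corrPairProb]
  | succ n ih =>
    have ih' := fun b c : Bool => ih (fun y => f (Fin.cons b y)) (fun y => g (Fin.cons c y))
      (fun _ => hf _) (fun _ => hg _)
    have hf0 : ∀ b : Bool, 0 ≤ (∑ y : Fin n → Bool, f (Fin.cons b y)) / 2 ^ n := fun b =>
      div_nonneg (Finset.sum_nonneg fun _ _ => hf _) (by positivity)
    have hg0 : ∀ b : Bool, 0 ≤ (∑ y : Fin n → Bool, g (Fin.cons b y)) / 2 ^ n := fun b =>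
      div_nonneg (Finset.sum_nonneg fun _ _ => hg _) (by positivity)
    have key := two_point_reverse_hypercontractive hs ht hρ hst
      (hf0 true) (hf0 false) (hg0 true) (hg0 false)
    have ef : ∀ F : (Fin (n + 1) → Bool) → ℝ, (∑ y, F y) / 2 ^ (n + 1) =
        ((∑ y : Fin n → Bool, F (Fin.cons true y)) / 2 ^ n +
          (∑ y : Fin n → Bool, F (Fin.cons false y)) / 2 ^ n) / 2 := fun F => by
      rw [sum_bool_pi_succ, pow_succ]; field_simp
    rw [ef f, ef g]
    refine key.trans ?_
    simp only [sum_bool_pi_succ, corrPairProb_cons, Finset.sum_add_distrib, mul_assoc,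
      ← Finset.mul_sum, if_true, Bool.true_eq_false, Bool.false_eq_true, if_false]
    have h1 : 0 ≤ (1 + ρ) / 4 := by linarith
    have h2 : 0 ≤ (1 - ρ) / 4 := by linarith
    have k1 := mul_le_mul_of_nonneg_left (ih' true true) h1
    have k2 := mul_le_mul_of_nonneg_left (ih' false false) h1
    have k3 := mul_le_mul_of_nonneg_left (ih' true false) h2
    have k4 := mul_le_mul_of_nonneg_left (ih' false true) h2
    linarith

lemma sum_indicator_eq_card {n : ℕ} (A : Finset (Fin n → Bool)) :
    ∑ y, (if y ∈ A then (1 : ℝ) else 0) = A.card := by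
  simp

lemma eq_univ_of_density_eq_one {n : ℕ} {A : Finset (Fin n → Bool)}
    (hA : (A.card : ℝ) / 2 ^ n = 1) : A = Finset.univ := by
  rw [← Finset.card_eq_iff_eq_univ, Fintype.card_fun, Fintype.card_bool, Fintype.card_fin]
  rw [div_eq_one_iff_eq (by positivity)] at hA
  exact_mod_cast hA

lemma exp_neg_div_one_sub_sq_le {ρ b : ℝ} (hρ : ρ ∈ Set.Ioo (0 : ℝ) 1) :
    Real.exp (-(1 / 2) * b ^ 2 / (1 - ρ ^ 2)) ≤ Real.exp (-b ^ 2 / 2) := by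
  have h1 : 0 < 1 - ρ ^ 2 := by nlinarith [hρ.1, hρ.2]
  rw [Real.exp_le_exp, div_le_iff₀ h1]
  nlinarith [mul_nonneg (sq_nonneg b) (sq_nonneg ρ)]

/-- (Reverse hypercontractive inequality, two-set form) If
`|A|/2^n = e^{−a²/2}`, `|B|/2^n = e^{−b²/2}` with `a, b ≥ 0` and `ρ ∈ (0,1)`,
and `(y, y')` is a `ρ`-correlated pair, then
`Pr[y ∈ A, y' ∈ B] ≥ exp(−(1/2)(a² + b² + 2ρab)/(1 − ρ²))`. -/
theorem reverse_hypercontractivity_two_sets (n : ℕ) (A B : Finset (Fin n → Bool))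
    (a b : ℝ) (ha : 0 ≤ a) (hb : 0 ≤ b)
    (hA : (A.card : ℝ) / 2 ^ n = Real.exp (-a ^ 2 / 2))
    (hB : (B.card : ℝ) / 2 ^ n = Real.exp (-b ^ 2 / 2))
    (ρ : ℝ) (hρ : ρ ∈ Set.Ioo (0 : ℝ) 1) :
    Real.exp (-(1 / 2) * (a ^ 2 + b ^ 2 + 2 * ρ * a * b) / (1 - ρ ^ 2)) ≤
      ∑ y : Fin n → Bool, ∑ y' : Fin n → Bool,
        (if y ∈ A ∧ y' ∈ B then corrPairProb n ρ y y' else 0) := by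
  have hρ2 : 0 < 1 - ρ ^ 2 := by nlinarith [hρ.1, hρ.2]
  have hρ0 := hρ.1
  rcases ha.eq_or_lt with rfl | ha
  · have hAu : A = Finset.univ := eq_univ_of_density_eq_one (by simpa using hA)
    have hsum : ∑ y : Fin n → Bool, ∑ y' : Fin n → Bool,
        (if y ∈ A ∧ y' ∈ B then corrPairProb n ρ y y' else 0) = (B.card : ℝ) / 2 ^ n := by
      rw [Finset.sum_comm]
      simp only [hAu, Finset.mem_univ, true_and, ← Finset.ite_sum_zero,
        corrPairProb_comm n ρ _, sum_corrPairProb]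
      simp [div_eq_mul_inv]
    rw [hsum, hB]
    simpa using exp_neg_div_one_sub_sq_le (b := b) hρ
  rcases hb.eq_or_lt with rfl | hb
  · have hBu : B = Finset.univ := eq_univ_of_density_eq_one (by simpa using hB)
    have hsum : ∑ y : Fin n → Bool, ∑ y' : Fin n → Bool,
        (if y ∈ A ∧ y' ∈ B then corrPairProb n ρ y y' else 0) = (A.card : ℝ) / 2 ^ n := by
      simp only [hBu, Finset.mem_univ, and_true, ← Finset.ite_sum_zero, sum_corrPairProb]
      simp [div_eq_mul_inv]
    rw [hsum, hA]
    simpa using exp_neg_div_one_sub_sq_le (b := a) hρ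
  have hab : 0 < a + ρ * b := by positivity
  have hba : 0 < b + ρ * a := by positivity
  have hs : 1 ≤ (a + ρ * b) / ((1 - ρ ^ 2) * a) := by
    rw [one_le_div (by positivity)]
    nlinarith [mul_pos hρ0 hb, mul_nonneg (sq_nonneg ρ) ha.le]
  have ht : 1 ≤ (b + ρ * a) / ((1 - ρ ^ 2) * b) := by
    rw [one_le_div (by positivity)]
    nlinarith [mul_pos hρ0 ha, mul_nonneg (sq_nonneg ρ) hb.le]
  have hst : ρ ^ 2 = (1 - 1 / ((a + ρ * b) / ((1 - ρ ^ 2) * a))) *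
      (1 - 1 / ((b + ρ * a) / ((1 - ρ ^ 2) * b))) := by
    field_simp
    ring
  have key := reverse_hypercontractive_two_functions hs ht hρ0.le hρ.2.le hst n
    (fun y => if y ∈ A then 1 else 0) (fun y => if y ∈ B then 1 else 0)
    (fun y => by positivity) (fun y => by positivity)
  have hs0 : (a + ρ * b) / ((1 - ρ ^ 2) * a) ≠ 0 := by linarith
  have ht0 : (b + ρ * a) / ((1 - ρ ^ 2) * b) ≠ 0 := by linarith
  rw [sum_indicator_eq_card, sum_indicator_eq_card, hA, hB, ← Real.exp_mul, ← Real.exp_mul,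
    ← Real.exp_add] at key
  refine le_trans (le_of_eq ?_) (key.trans (le_of_eq ?_))
  · congr 1
    field_simp
    ring
  · refine Finset.sum_congr rfl fun y _ => Finset.sum_congr rfl fun z _ => ?_
    by_cases hy : y ∈ A <;> by_cases hz : z ∈ B <;>
      simp [hy, hz, Real.zero_rpow hs0, Real.zero_rpow ht0]
end

section
/- Let n ≥ r ≥ 1 be integers, let S, S' ⊆ [n] be subsets of size r, and let h ∈ 𝔽₂^n. Let ι_S : 𝔽₂^r → 𝔽₂^n be the linear map placing the r coordinates of its input on the positions of S (in increasing order) and 0 elsewhere, and let π_S : 𝔽₂^n → 𝔽₂^r be the restriction map to the coordinates of S; define ι_{S'}, π_{S'} analogously. Suppose A, B : 𝔽₂^n → {0,1} satisfy A(x)·A(x + ι_S(z) + h)·B(y)·B(y + ι_{S'}(z)) = 0 for all x, y ∈ 𝔽₂^n and all z ∈ 𝔽₂^r with z ≠ 0. Then Σ Â_α² B̂_β² ≥ Â_0² B̂_0² − 2^{−r}, where the sum is over all pairs (α, β) ∈ 𝔽₂^n × 𝔽₂^n with π_S(α) = π_{S'}(β) and α·h = 1. -/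
open Finset

/-- The inner product `α·x = Σ_i α_i x_i` over the field `𝔽₂`. -/
def f2Inner {n : ℕ} (α x : Fin n → ZMod 2) : ZMod 2 := ∑ i, α i * x i

/-- The Fourier coefficient `Â_α = E_{x ∈ 𝔽₂^n}[A(x)·(−1)^{α·x}]`. -/
noncomputable def f2Coef {n : ℕ} (A : (Fin n → ZMod 2) → ℝ) (α : Fin n → ZMod 2) : ℝ :=
  (∑ x : Fin n → ZMod 2, A x * (-1 : ℝ) ^ (f2Inner α x).val) / 2 ^ n

/-- The linear map `ι_S : 𝔽₂^r → 𝔽₂^n` placing the `r` input coordinates on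
the positions of `S` in increasing order and `0` elsewhere. -/
noncomputable def iotaS {n r : ℕ} (S : Finset (Fin n)) (hS : S.card = r)
    (z : Fin r → ZMod 2) : Fin n → ZMod 2 :=
  fun i => if hi : i ∈ S then z ((S.orderIsoOfFin hS).symm ⟨i, hi⟩) else 0

/-- The restriction map `π_S : 𝔽₂^n → 𝔽₂^r` to the coordinates of `S` in
increasing order. -/
noncomputable def projS {n r : ℕ} (S : Finset (Fin n)) (hS : S.card = r)
    (x : Fin n → ZMod 2) : Fin r → ZMod 2 :=
  fun k => x ((S.orderIsoOfFin hS) k)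

/-- The character `χ_α(x) = (−1)^{α·x}` of `𝔽₂^n`. -/
noncomputable def f2Char {n : ℕ} (α x : Fin n → ZMod 2) : ℝ :=
  (-1 : ℝ) ^ (f2Inner α x).val

lemma f2Inner_comm {n : ℕ} (α x : Fin n → ZMod 2) : f2Inner α x = f2Inner x α := by
  simp only [f2Inner, mul_comm]

lemma f2Inner_add_right {n : ℕ} (α x y : Fin n → ZMod 2) :
    f2Inner α (x + y) = f2Inner α x + f2Inner α y := by
  simp only [f2Inner, Pi.add_apply, mul_add, sum_add_distrib]

lemma neg_one_pow_zmod_two_val_add (a b : ZMod 2) :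
    (-1 : ℝ) ^ (a + b).val = (-1) ^ a.val * (-1) ^ b.val := by
  rw [← pow_add, ZMod.val_add, ← neg_one_pow_eq_pow_mod_two]

lemma f2Char_comm {n : ℕ} (α x : Fin n → ZMod 2) : f2Char α x = f2Char x α := by
  rw [f2Char, f2Inner_comm, f2Char]

lemma f2Char_add_right {n : ℕ} (α x y : Fin n → ZMod 2) :
    f2Char α (x + y) = f2Char α x * f2Char α y := by
  rw [f2Char, f2Inner_add_right, neg_one_pow_zmod_two_val_add, f2Char, f2Char]

lemma f2Char_add_left {n : ℕ} (α β x : Fin n → ZMod 2) :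
    f2Char (α + β) x = f2Char α x * f2Char β x := by
  simp only [f2Char_comm _ x, f2Char_add_right]

lemma add_eq_zero_iff_eq_of_zmod_two {ι : Type*} (x y : ι → ZMod 2) : x + y = 0 ↔ x = y := by
  rw [add_eq_zero_iff_eq_neg, ZModModule.neg_eq_self]

/-- Orthogonality of characters. -/
lemma sum_f2Char {n : ℕ} (w : Fin n → ZMod 2) :
    ∑ α, f2Char α w = if w = 0 then (2 : ℝ) ^ n else 0 := by
  split_ifs with hw
  · subst hw
    simp [f2Char, f2Inner, ZMod.card]
  · obtain ⟨i, hi⟩ := Function.ne_iff.mp hw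
    have hi1 : w i = 1 := by
      have : ∀ a : ZMod 2, a ≠ 0 → a = 1 := by decide
      exact this _ hi
    have hchar : f2Char (Pi.single i 1) w = -1 := by
      simp [f2Char, f2Inner, Pi.single_apply, hi1, ZMod.val_one]
    have hsum := Equiv.sum_comp (Equiv.addRight (Pi.single i (1 : ZMod 2))) (f2Char · w)
    simp only [Equiv.coe_addRight, f2Char_add_left, hchar, ← sum_mul] at hsum
    linarith

/-- Autocorrelations in terms of squared Fourier coefficients. -/
lemma sum_f2Coef_sq_mul_f2Char {n : ℕ} (A : (Fin n → ZMod 2) → ℝ) (w : Fin n → ZMod 2) :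
    ∑ α, f2Coef A α ^ 2 * f2Char α w = (∑ x, A x * A (x + w)) / 2 ^ n := by
  have expand (α : Fin n → ZMod 2) : f2Coef A α ^ 2 * f2Char α w =
      (∑ x, ∑ y, A x * A y * f2Char α (x + w + y)) / (2 ^ n * 2 ^ n) := by
    rw [f2Coef, div_pow, sq, sum_mul_sum, sq, div_mul_eq_mul_div, sum_mul]
    congr 1
    refine sum_congr rfl fun x _ => ?_
    rw [sum_mul]
    refine sum_congr rfl fun y _ => ?_
    rw [f2Char_add_right, f2Char_add_right]
    simp only [f2Char]
    ring
  simp only [expand]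
  rw [← sum_div, sum_comm]
  have inner (x : Fin n → ZMod 2) : ∑ α, ∑ y, A x * A y * f2Char α (x + w + y) =
      A x * A (x + w) * 2 ^ n := by
    rw [sum_comm]
    simp only [← mul_sum, sum_f2Char, add_eq_zero_iff_eq_of_zmod_two]
    simp
  simp only [inner]
  rw [← sum_mul, mul_div_mul_right _ _ (by positivity)]

lemma f2Inner_iotaS {n r : ℕ} (S : Finset (Fin n)) (hS : S.card = r)
    (α : Fin n → ZMod 2) (z : Fin r → ZMod 2) :
    f2Inner α (iotaS S hS z) = f2Inner (projS S hS α) z := by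
  have hsub : ∑ i, α i * iotaS S hS z i = ∑ i ∈ S, α i * iotaS S hS z i := by
    refine (sum_subset (subset_univ S) fun i _ hi => ?_).symm
    simp [iotaS, hi]
  rw [f2Inner, hsub, ← sum_coe_sort, ← Equiv.sum_comp (S.orderIsoOfFin hS).toEquiv, f2Inner]
  refine sum_congr rfl fun k _ => ?_
  have hz : iotaS S hS z (S.orderIsoOfFin hS k) = z k := by
    rw [iotaS, dif_pos (S.orderIsoOfFin hS k).2, Subtype.coe_eta, OrderIso.symm_apply_apply]
  exact congrArg _ hz

lemma f2Char_iotaS {n r : ℕ} (S : Finset (Fin n)) (hS : S.card = r)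
    (α : Fin n → ZMod 2) (z : Fin r → ZMod 2) :
    f2Char α (iotaS S hS z) = f2Char (projS S hS α) z := by
  rw [f2Char, f2Inner_iotaS, f2Char]

/-- The signed Fourier mass on pairs with matching projections, as an average of products of
autocorrelations. -/
lemma sum_signed_fourier_mass {n r : ℕ} (S S' : Finset (Fin n)) (hS : S.card = r)
    (hS' : S'.card = r) (h : Fin n → ZMod 2) (A B : (Fin n → ZMod 2) → ℝ) :
    (∑ α, ∑ β, if projS S hS α = projS S' hS' β then
        f2Coef A α ^ 2 * f2Coef B β ^ 2 * f2Char α h else 0) * 2 ^ r =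
      ∑ z, (∑ x, A x * A (x + iotaS S hS z + h)) / 2 ^ n *
        ((∑ y, B y * B (y + iotaS S' hS' z)) / 2 ^ n) := by
  simp only [add_assoc, ← sum_f2Coef_sq_mul_f2Char, sum_mul_sum]
  rw [sum_mul, sum_comm]
  refine sum_congr rfl fun α _ => ?_
  rw [sum_mul, sum_comm]
  refine sum_congr rfl fun β _ => ?_
  have factor (z : Fin r → ZMod 2) :
      f2Coef A α ^ 2 * f2Char α (iotaS S hS z + h) *
        (f2Coef B β ^ 2 * f2Char β (iotaS S' hS' z)) =
      f2Coef A α ^ 2 * f2Coef B β ^ 2 * f2Char α h *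
        f2Char z (projS S hS α + projS S' hS' β) := by
    rw [f2Char_add_right, f2Char_add_right, f2Char_iotaS, f2Char_iotaS, f2Char_comm z,
      f2Char_comm z]
    ring
  simp only [factor]
  rw [← mul_sum, sum_f2Char]
  simp only [add_eq_zero_iff_eq_of_zmod_two]
  split_ifs <;> simp

lemma autocorrelation_mem_Icc {n : ℕ} {A : (Fin n → ZMod 2) → ℝ}
    (hA : ∀ x, A x = 0 ∨ A x = 1) (f : (Fin n → ZMod 2) → Fin n → ZMod 2) :
    (∑ x, A x * A (f x)) / 2 ^ n ∈ Set.Icc (0 : ℝ) 1 := by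
  have hterm (x : Fin n → ZMod 2) : 0 ≤ A x * A (f x) ∧ A x * A (f x) ≤ 1 := by
    rcases hA x with h1 | h1 <;> rcases hA (f x) with h2 | h2 <;> simp [h1, h2]
  refine ⟨div_nonneg (sum_nonneg fun x _ => (hterm x).1) (by positivity), ?_⟩
  rw [div_le_one (by positivity)]
  calc ∑ x, A x * A (f x) ≤ ∑ _x : Fin n → ZMod 2, (1 : ℝ) := sum_le_sum fun x _ => (hterm x).2
    _ = 2 ^ n := by simp [ZMod.card]

/-- Let `S, S' ⊆ [n]` have size `r` and `h ∈ 𝔽₂^n`.  If `A, B : 𝔽₂^n → {0,1}`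
satisfy `A(x)·A(x + ι_S(z) + h)·B(y)·B(y + ι_{S'}(z)) = 0` for all `x, y` and
all `z ≠ 0`, then the sum of `Â_α² B̂_β²` over pairs with `π_S(α) = π_{S'}(β)`
and `α·h = 1` is at least `Â_0² B̂_0² − 2^{−r}`. -/
theorem fourier_mass_on_odd_pairs (n r : ℕ) (hr : 1 ≤ r) (hn : r ≤ n)
    (S S' : Finset (Fin n)) (hS : S.card = r) (hS' : S'.card = r)
    (h : Fin n → ZMod 2) (A B : (Fin n → ZMod 2) → ℝ)
    (hA : ∀ x, A x = 0 ∨ A x = 1) (hB : ∀ x, B x = 0 ∨ B x = 1)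
    (hyp : ∀ x y : Fin n → ZMod 2, ∀ z : Fin r → ZMod 2, z ≠ 0 →
      A x * A (x + iotaS S hS z + h) * B y * B (y + iotaS S' hS' z) = 0) :
    f2Coef A 0 ^ 2 * f2Coef B 0 ^ 2 - 1 / 2 ^ r ≤
      ∑ α : Fin n → ZMod 2, ∑ β : Fin n → ZMod 2,
        (if projS S hS α = projS S' hS' β ∧ f2Inner α h = 1 then
          f2Coef A α ^ 2 * f2Coef B β ^ 2 else 0) := by
  have upper : (∑ α, ∑ β, if projS S hS α = projS S' hS' β then
      f2Coef A α ^ 2 * f2Coef B β ^ 2 * f2Char α h else 0) ≤ 1 / 2 ^ r := by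
    rw [le_div_iff₀ (by positivity), sum_signed_fourier_mass, Fintype.sum_eq_single 0]
    · have hA1 := autocorrelation_mem_Icc hA fun x => x + iotaS S hS 0 + h
      have hB1 := autocorrelation_mem_Icc hB fun y => y + iotaS S' hS' 0
      exact mul_le_one₀ hA1.2 hB1.1 hB1.2
    · intro z hz
      rw [div_mul_div_comm, sum_mul_sum]
      simp only [← mul_assoc, hyp _ _ z hz, sum_const_zero, zero_div]
  have lower : f2Coef A 0 ^ 2 * f2Coef B 0 ^ 2 ≤
      ∑ α, ∑ β, ((if projS S hS α = projS S' hS' β then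
          f2Coef A α ^ 2 * f2Coef B β ^ 2 * f2Char α h else 0) +
        if projS S hS α = projS S' hS' β ∧ f2Inner α h = 1 then
          f2Coef A α ^ 2 * f2Coef B β ^ 2 else 0) := by
    have term_nonneg (α β : Fin n → ZMod 2) :
        0 ≤ (if projS S hS α = projS S' hS' β then
            f2Coef A α ^ 2 * f2Coef B β ^ 2 * f2Char α h else 0) +
          if projS S hS α = projS S' hS' β ∧ f2Inner α h = 1 then
            f2Coef A α ^ 2 * f2Coef B β ^ 2 else 0 := by
      have hcases : ∀ a : ZMod 2, a = 0 ∨ a = 1 := by decide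
      by_cases hp : projS S hS α = projS S' hS' β
      · rcases hcases (f2Inner α h) with h0 | h1
        · simp only [hp, f2Char, h0, ZMod.val_zero, pow_zero]
          simp only [if_true, true_and, zero_ne_one, if_false]
          positivity
        · simp [hp, f2Char, h1, ZMod.val_one]
      · simp [hp]
    refine le_trans ?_ (single_le_sum (fun α _ => sum_nonneg fun β _ => term_nonneg α β)
      (mem_univ 0))
    refine le_trans ?_ (single_le_sum (fun β _ => term_nonneg 0 β) (mem_univ 0))
    have hproj : projS S hS 0 = projS S' hS' 0 := rfl
    simp [hproj, f2Char, f2Inner]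
  simp only [sum_add_distrib] at lower
  linarith
end

section
/- Let R_1, R_2 be finite sets, π : R_2 → R_1 a map, η ∈ (0,1), ν > 0, and s ≥ 1 an integer with (1−η)^s ≤ ν. Let f : {−1,1}^{R_2} → [0,1]. Say that α ⊆ R_2 is shattered by π if |π(α)| = |α|. Define f_1 = Σ_{α : |α| ≥ s} f̂_α χ_α, f_2 = Σ_{α : |α| < s, α not shattered by π} f̂_α χ_α, and f_3 = Σ_{α : |α| < s, α shattered by π} f̂_α χ_α. Then |E_y[f(y)·(T_{1−η}f)(−y)] − E_y[f_3(y)·(T_{1−η}f_3)(−y)]| ≤ 2‖f_2‖_2 + 2ν, where the expectation is over uniform y ∈ {−1,1}^{R_2} and −y denotes coordinatewise negation. -/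
open Finset

/-- The Bonami–Beckner operator `T_ρ f = Σ_α ρ^{|α|} f̂_α χ_α`. -/
noncomputable def bonamiBeckner {R : Type*} [Fintype R] [DecidableEq R]
    (ρ : ℝ) (f : (R → Bool) → ℝ) : (R → Bool) → ℝ :=
  fun x => ∑ α : Finset R, ρ ^ α.card * fcoef f α * chiChar α x

section FourierCube

variable {R : Type*}

lemma chiChar_not (α : Finset R) (x : R → Bool) :
    chiChar α (fun j => !(x j)) = (-1) ^ α.card * chiChar α x := by
  unfold chiChar
  rw [← Finset.prod_const, ← Finset.prod_mul_distrib]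
  refine Finset.prod_congr rfl fun j _ => ?_
  cases hx : x j <;> simp [hx]

variable [Fintype R] [DecidableEq R]

/-- Characters are orthonormal with respect to the uniform measure. -/
lemma fcoef_chiChar (α β : Finset R) :
    fcoef (chiChar β) α = if α = β then 1 else 0 := by
  have hprod : ∑ x : R → Bool, chiChar β x * chiChar α x =
      ∏ j : R, ∑ b : Bool, (if j ∈ β then (if b then (1 : ℝ) else -1) else 1) *
        (if j ∈ α then (if b then (1 : ℝ) else -1) else 1) := by
    rw [Finset.prod_univ_sum, Fintype.piFinset_univ]
    refine Finset.sum_congr rfl fun x _ => ?_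
    rw [Finset.prod_mul_distrib, Finset.prod_ite_mem, Finset.prod_ite_mem]
    simp [chiChar]
  unfold fcoef
  rw [hprod]
  split_ifs with h
  · subst h
    rw [div_eq_one_iff_eq (by positivity), ← Finset.card_univ, ← Finset.prod_const]
    refine Finset.prod_congr rfl fun j _ => ?_
    by_cases hj : j ∈ α <;> norm_num [hj]
  · obtain ⟨j, hj⟩ : ∃ j, ¬(j ∈ α ↔ j ∈ β) := by
      by_contra! hall
      exact h (Finset.ext hall)
    rw [Finset.prod_eq_zero (Finset.mem_univ j), zero_div]
    by_cases h₁ : j ∈ α <;> by_cases h₂ : j ∈ β <;> simp_all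

lemma fcoef_sum_mul_chiChar (A : Finset (Finset R)) (c : Finset R → ℝ) (α : Finset R) :
    fcoef (fun x => ∑ β ∈ A, c β * chiChar β x) α = if α ∈ A then c α else 0 := by
  have hlin : fcoef (fun x => ∑ β ∈ A, c β * chiChar β x) α =
      ∑ β ∈ A, c β * fcoef (chiChar β) α := by
    simp only [fcoef, Finset.sum_mul, ← mul_div_assoc, ← Finset.sum_div, Finset.mul_sum]
    rw [Finset.sum_comm]
    simp only [mul_assoc]
  simp [hlin, fcoef_chiChar]

lemma expectation_mul_sum_chiChar (f : (R → Bool) → ℝ) (A : Finset (Finset R))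
    (c : Finset R → ℝ) :
    (∑ x, f x * ∑ α ∈ A, c α * chiChar α x) / 2 ^ Fintype.card R =
      ∑ α ∈ A, c α * fcoef f α := by
  simp only [fcoef, Finset.mul_sum, ← mul_div_assoc, ← Finset.sum_div]
  rw [Finset.sum_comm]
  simp only [mul_left_comm]

/-- Parseval's identity for a function given by its Fourier expansion. -/
lemma expectation_sq_sum_chiChar (A : Finset (Finset R)) (c : Finset R → ℝ) :
    (∑ x : R → Bool, (∑ α ∈ A, c α * chiChar α x) ^ 2) / 2 ^ Fintype.card R =
      ∑ α ∈ A, c α ^ 2 := by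
  simp only [sq]
  rw [expectation_mul_sum_chiChar (fun x => ∑ α ∈ A, c α * chiChar α x)]
  refine Finset.sum_congr rfl fun α hα => ?_
  rw [fcoef_sum_mul_chiChar, if_pos hα]

/-- Bessel's inequality. -/
lemma sum_fcoef_sq_le (f : (R → Bool) → ℝ) (A : Finset (Finset R)) :
    ∑ α ∈ A, fcoef f α ^ 2 ≤ (∑ x, f x ^ 2) / 2 ^ Fintype.card R := by
  have hnonneg : 0 ≤ (∑ x, (f x - ∑ α ∈ A, fcoef f α * chiChar α x) ^ 2) /
      2 ^ Fintype.card R := by positivity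
  have hcross := expectation_mul_sum_chiChar f A (fcoef f)
  have hsq := expectation_sq_sum_chiChar A (fcoef f)
  simp only [sub_sq, Finset.sum_add_distrib, Finset.sum_sub_distrib, add_div, sub_div,
    mul_assoc, ← Finset.mul_sum, hsq] at hnonneg
  rw [mul_div_assoc, hcross] at hnonneg
  simp only [← sq] at hnonneg
  linarith

lemma expectation_mul_bonamiBeckner_not (ρ : ℝ) (f : (R → Bool) → ℝ) :
    (∑ y, f y * bonamiBeckner ρ f (fun j => !(y j))) / 2 ^ Fintype.card R =
      ∑ α, (-ρ) ^ α.card * fcoef f α ^ 2 := by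
  have hexp : ∀ y, bonamiBeckner ρ f (fun j => !(y j)) =
      ∑ α, (-ρ) ^ α.card * fcoef f α * chiChar α y := fun y => by
    refine Finset.sum_congr rfl fun α _ => ?_
    rw [chiChar_not, neg_pow ρ]
    ring
  simp only [hexp]
  rw [expectation_mul_sum_chiChar f _ fun α => (-ρ) ^ α.card * fcoef f α]
  simp only [mul_assoc, sq]

end FourierCube

/-- Let `π : R₂ → R₁`, `η ∈ (0,1)`, `ν > 0` and `s ≥ 1` with `(1−η)^s ≤ ν`,
and let `f : {−1,1}^{R₂} → [0,1]`.  With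
`f₂ = Σ_{|α| < s, α not shattered by π} f̂_α χ_α` and
`f₃ = Σ_{|α| < s, α shattered by π} f̂_α χ_α` (where `α` is shattered if
`|π(α)| = |α|`), one has
`|E_y[f(y)·(T_{1−η}f)(−y)] − E_y[f₃(y)·(T_{1−η}f₃)(−y)]| ≤ 2‖f₂‖₂ + 2ν`. -/
theorem expectation_decomposition_shattered {R₁ R₂ : Type*}
    [Fintype R₂] [DecidableEq R₂] [DecidableEq R₁]
    (π : R₂ → R₁) (η ν : ℝ) (hη : η ∈ Set.Ioo (0 : ℝ) 1) (hν : 0 < ν)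
    (s : ℕ) (hs : 1 ≤ s) (hsν : (1 - η) ^ s ≤ ν)
    (f : (R₂ → Bool) → ℝ) (hf : ∀ x, f x ∈ Set.Icc (0 : ℝ) 1) :
    let f₂ : (R₂ → Bool) → ℝ := fun x =>
      ∑ α ∈ Finset.univ.filter
        (fun α : Finset R₂ => α.card < s ∧ (α.image π).card ≠ α.card),
        fcoef f α * chiChar α x
    let f₃ : (R₂ → Bool) → ℝ := fun x =>
      ∑ α ∈ Finset.univ.filter
        (fun α : Finset R₂ => α.card < s ∧ (α.image π).card = α.card),
        fcoef f α * chiChar α x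
    |(∑ y : R₂ → Bool, f y * bonamiBeckner (1 - η) f (fun j => !(y j))) /
        2 ^ Fintype.card R₂ -
      (∑ y : R₂ → Bool, f₃ y * bonamiBeckner (1 - η) f₃ (fun j => !(y j))) /
        2 ^ Fintype.card R₂| ≤ 2 * norm2 f₂ + 2 * ν := by
  intro f₂ f₃
  obtain ⟨hη₀, hη₁⟩ := hη
  have hbessel : ∀ A : Finset (Finset R₂), ∑ α ∈ A, fcoef f α ^ 2 ≤ 1 := fun A => by
    refine (sum_fcoef_sq_le f A).trans (div_le_one_of_le₀ ?_ (by positivity))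
    calc ∑ x, f x ^ 2 ≤ ∑ _x : R₂ → Bool, (1 : ℝ) :=
          Finset.sum_le_sum fun x _ => pow_le_one₀ (hf x).1 (hf x).2
      _ = 2 ^ Fintype.card R₂ := by simp
  set A₂ := Finset.univ.filter
    (fun α : Finset R₂ => α.card < s ∧ (α.image π).card ≠ α.card) with hA₂
  have hnorm : norm2 f₂ = Real.sqrt (∑ α ∈ A₂, fcoef f α ^ 2) := by
    rw [norm2, expectation_sq_sum_chiChar]
  have hA₂_le : ∑ α ∈ A₂, fcoef f α ^ 2 ≤ norm2 f₂ := by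
    rw [hnorm]
    exact Real.le_sqrt_of_sq_le
      (pow_le_of_le_one (Finset.sum_nonneg fun _ _ => sq_nonneg _) (hbessel A₂) two_ne_zero)
  have hnorm_nonneg : 0 ≤ norm2 f₂ := Real.sqrt_nonneg _
  have hterm : ∀ α : Finset R₂,
      |(-(1 - η)) ^ α.card * fcoef f α ^ 2 - (-(1 - η)) ^ α.card * fcoef f₃ α ^ 2| ≤
        (if α ∈ A₂ then fcoef f α ^ 2 else 0) + ν * fcoef f α ^ 2 := fun α => by
    have hsq := sq_nonneg (fcoef f α)
    have hνsq : 0 ≤ ν * fcoef f α ^ 2 := by positivity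
    rw [fcoef_sum_mul_chiChar, ← mul_sub, abs_mul, abs_pow, abs_neg,
      abs_of_pos (sub_pos.2 hη₁)]
    simp only [hA₂, Finset.mem_filter, Finset.mem_univ, true_and]
    by_cases hcard : α.card < s
    · by_cases hshat : (α.image π).card = α.card
      · simpa [hcard, hshat] using hνsq
      · have hpow : (1 - η) ^ α.card ≤ 1 := pow_le_one₀ (by linarith) (by linarith)
        simp only [hcard, hshat, ne_eq, not_false_eq_true, and_self, and_false, if_true,
          if_false, zero_pow two_ne_zero, sub_zero, abs_of_nonneg hsq]
        nlinarith
    · have hpow : (1 - η) ^ α.card ≤ ν :=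
        (pow_le_pow_of_le_one (by linarith) (by linarith) (not_lt.1 hcard)).trans hsν
      simp only [hcard, false_and, if_false, zero_pow two_ne_zero, sub_zero,
        abs_of_nonneg hsq, zero_add]
      exact mul_le_mul_of_nonneg_right hpow hsq
  rw [expectation_mul_bonamiBeckner_not, expectation_mul_bonamiBeckner_not,
    ← Finset.sum_sub_distrib]
  calc _ ≤ ∑ α : Finset R₂, ((if α ∈ A₂ then fcoef f α ^ 2 else 0) + ν * fcoef f α ^ 2) :=
        (Finset.abs_sum_le_sum_abs _ _).trans (Finset.sum_le_sum fun α _ => hterm α)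
    _ = ∑ α ∈ A₂, fcoef f α ^ 2 + ν * ∑ α, fcoef f α ^ 2 := by
        rw [Finset.sum_add_distrib, Finset.mul_sum, Finset.sum_ite_mem, Finset.univ_inter]
    _ ≤ norm2 f₂ + ν * 1 := add_le_add hA₂_le (mul_le_mul_of_nonneg_left (hbessel _) hν.le)
    _ ≤ 2 * norm2 f₂ + 2 * ν := by linarith
end
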